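/- arXiv:2309.14275 — 2 statements merged into one kernel-verified Lean document; each statement's English description precedes it below -/
import Mathlib

section
/- There exists a constant c > 0 such that for every finite set S ⊂ ℝ² of n points and every integer k ≥ 2, the number of points ξ ∈ S with the property that there exist two distinct lines ℓ₁, ℓ₂ in ℝ² both passing through ξ with #(ℓ₁ ∩ S) ≥ k and #(ℓ₂ ∩ S) ≥ k is at most c (n²/k³ + n/k)². -/
open scoped BigOperators

/-- An affine line in the plane `ℝ²`. -/
def IsLine (ℓ : Set (ℝ × ℝ)) : Prop :=
  ∃ p v : ℝ × ℝ, v ≠ 0 ∧ ℓ = {x | ∃ t : ℝ, x = p + t • v}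

theorem IsLine.eq_of_mem {ℓ : Set (ℝ × ℝ)} (h : IsLine ℓ) {x y : ℝ × ℝ} (hx : x ∈ ℓ)
    (hy : y ∈ ℓ) (hxy : x ≠ y) : ℓ = {z | ∃ t : ℝ, z = x + t • (y - x)} := by
  obtain ⟨p, v, -, rfl⟩ := h
  obtain ⟨a, rfl⟩ := hx
  obtain ⟨b, rfl⟩ := hy
  have hab : b - a ≠ 0 := fun h => hxy (by rw [sub_eq_zero.mp h])
  ext z
  constructor
  · rintro ⟨t, rfl⟩
    refine ⟨(t - a) / (b - a), ?_⟩
    rw [add_sub_add_left_eq_sub, ← sub_smul, smul_smul, div_mul_cancel₀ _ hab, add_assoc,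
      ← add_smul, add_sub_cancel]
  · rintro ⟨t, rfl⟩
    refine ⟨a + t * (b - a), ?_⟩
    rw [add_sub_add_left_eq_sub, ← sub_smul, smul_smul, add_assoc, ← add_smul]

theorem IsLine.eq_of_two_points {ℓ₁ ℓ₂ : Set (ℝ × ℝ)} (h₁ : IsLine ℓ₁) (h₂ : IsLine ℓ₂)
    {x y : ℝ × ℝ} (hxy : x ≠ y) (hx₁ : x ∈ ℓ₁) (hx₂ : x ∈ ℓ₂) (hy₁ : y ∈ ℓ₁) (hy₂ : y ∈ ℓ₂) :
    ℓ₁ = ℓ₂ :=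
  (h₁.eq_of_mem hx₁ hy₁ hxy).trans (h₂.eq_of_mem hx₂ hy₂ hxy).symm

/-- Cauchy–Schwarz bound on the incidences of a linear set system. -/
theorem sq_sum_card_le_of_card_inter_le_one {α : Type*} [DecidableEq α] (S : Finset α)
    (T : Finset (Finset α)) (hS : ∀ A ∈ T, A ⊆ S)
    (hT : ∀ A ∈ T, ∀ B ∈ T, A ≠ B → (A ∩ B).card ≤ 1) :
    (∑ A ∈ T, (A.card : ℝ)) ^ 2 ≤
      S.card * (∑ A ∈ T, (A.card : ℝ) + (T.card : ℝ) ^ 2) := by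
  have ind (A : Finset α) (hA : A ⊆ S) :
      (A.card : ℝ) = ∑ p ∈ S, if p ∈ A then (1 : ℝ) else 0 := by
    rw [Finset.sum_boole, Finset.filter_mem_eq_inter, Finset.inter_eq_right.mpr hA]
  have hI : ∑ A ∈ T, (A.card : ℝ) = ∑ p ∈ S, ∑ A ∈ T, if p ∈ A then (1 : ℝ) else 0 := by
    rw [Finset.sum_comm]
    exact Finset.sum_congr rfl fun A hA => ind A (hS A hA)
  have hsq : ∑ p ∈ S, (∑ A ∈ T, if p ∈ A then (1 : ℝ) else 0) ^ 2 =
      ∑ A ∈ T, ∑ B ∈ T, ((A ∩ B).card : ℝ) := by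
    simp_rw [sq, Finset.sum_mul_sum]
    rw [Finset.sum_comm]
    refine Finset.sum_congr rfl fun A hA => ?_
    rw [Finset.sum_comm]
    refine Finset.sum_congr rfl fun B _ => ?_
    rw [ind _ (Finset.inter_subset_left.trans (hS A hA))]
    refine Finset.sum_congr rfl fun p _ => ?_
    by_cases hpA : p ∈ A <;> by_cases hpB : p ∈ B <;> simp [hpA, hpB]
  have hpairs : ∑ A ∈ T, ∑ B ∈ T, ((A ∩ B).card : ℝ) ≤
      ∑ A ∈ T, ∑ B ∈ T, ((if A = B then (A.card : ℝ) else 0) + 1) := by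
    refine Finset.sum_le_sum fun A hA => Finset.sum_le_sum fun B hB => ?_
    by_cases h : A = B
    · simp [h]
    · simpa [h] using hT A hA B hB h
  have heval : ∑ A ∈ T, ∑ B ∈ T, ((if A = B then (A.card : ℝ) else 0) + 1) =
      ∑ A ∈ T, (A.card : ℝ) + (T.card : ℝ) ^ 2 := by
    simp only [Finset.sum_add_distrib, Finset.sum_ite_eq, Finset.sum_const, nsmul_eq_mul,
      mul_one, sq]
    congr 1
    exact Finset.sum_congr rfl fun A hA => if_pos hA
  calc (∑ A ∈ T, (A.card : ℝ)) ^ 2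
      ≤ S.card * ∑ p ∈ S, (∑ A ∈ T, if p ∈ A then (1 : ℝ) else 0) ^ 2 := by
        rw [hI]; exact sq_sum_le_card_mul_sum_sq
    _ ≤ _ := by
        rw [hsq, ← heval]
        exact mul_le_mul_of_nonneg_left hpairs (Nat.cast_nonneg _)

/-- A linear set system whose members are large compared with the square root of the size of the
ground set has few members. -/
theorem card_mul_le_of_card_inter_le_one {α : Type*} [DecidableEq α] (S : Finset α)
    (T : Finset (Finset α)) (k : ℕ) (hS : ∀ A ∈ T, A ⊆ S) (hk : ∀ A ∈ T, k ≤ A.card)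
    (hT : ∀ A ∈ T, ∀ B ∈ T, A ≠ B → (A ∩ B).card ≤ 1) (hkS : 4 * S.card < k ^ 2) :
    (T.card : ℝ) * k ≤ 2 * S.card := by
  have hCS := sq_sum_card_le_of_card_inter_le_one S T hS hT
  have hI : (T.card : ℝ) * k ≤ ∑ A ∈ T, (A.card : ℝ) := by
    rw [← nsmul_eq_mul]
    exact Finset.card_nsmul_le_sum _ _ _ fun A hA => by exact_mod_cast hk A hA
  have hkS' : 4 * (S.card : ℝ) < (k : ℝ) ^ 2 := by exact_mod_cast hkS
  set I := ∑ A ∈ T, (A.card : ℝ)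
  set m : ℝ := (T.card : ℝ)
  set n : ℝ := (S.card : ℝ)
  have hm : 0 ≤ m := Nat.cast_nonneg _
  have hn : 0 ≤ n := Nat.cast_nonneg _
  by_contra! hlt
  have hmk : 0 < m * k := by linarith
  have h1 : (m * k) * (m * k - n) ≤ I * (I - n) :=
    mul_le_mul hI (by linarith) (by linarith) (by linarith)
  have h2 : (m * k) * (m * k) < 2 * ((m * k) * (m * k - n)) := by nlinarith
  have h3 : 4 * n * m ^ 2 ≤ (k : ℝ) ^ 2 * m ^ 2 :=
    mul_le_mul_of_nonneg_right hkS'.le (sq_nonneg m)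
  nlinarith

/-- **Bound on intersections of two rich lines (estimate (3.3)).**
There exists `c > 0` such that for every finite set `S ⊂ ℝ²` of `n` points and
every integer `k ≥ 2`, the number of points `ξ ∈ S` lying on two distinct lines
each containing at least `k` points of `S` is at most `c (n²/k³ + n/k)²`. -/
theorem rich_lines_intersections_bound :
    ∃ c : ℝ, 0 < c ∧
      ∀ (S : Finset (ℝ × ℝ)) (k : ℕ), 2 ≤ k →
        ({ξ : ℝ × ℝ | ξ ∈ S ∧ ∃ ℓ₁ ℓ₂ : Set (ℝ × ℝ),
            IsLine ℓ₁ ∧ IsLine ℓ₂ ∧ ℓ₁ ≠ ℓ₂ ∧ ξ ∈ ℓ₁ ∧ ξ ∈ ℓ₂ ∧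
            k ≤ (ℓ₁ ∩ (S : Set (ℝ × ℝ))).ncard ∧
            k ≤ (ℓ₂ ∩ (S : Set (ℝ × ℝ))).ncard}.ncard : ℝ) ≤
          c * ((S.card : ℝ) ^ 2 / (k : ℝ) ^ 3 + (S.card : ℝ) / (k : ℝ)) ^ 2 := by
  classical
  refine ⟨64, by norm_num, fun S k hk => ?_⟩
  have hk0 : (0 : ℝ) < k := by exact_mod_cast (by omega : 0 < k)
  rcases le_or_gt (k ^ 2) (4 * S.card) with hkS | hkS
  · -- When `k² ≤ 4n` the right-hand side is at least `n`.
    have hle : ({ξ : ℝ × ℝ | ξ ∈ S ∧ ∃ ℓ₁ ℓ₂ : Set (ℝ × ℝ),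
            IsLine ℓ₁ ∧ IsLine ℓ₂ ∧ ℓ₁ ≠ ℓ₂ ∧ ξ ∈ ℓ₁ ∧ ξ ∈ ℓ₂ ∧
            k ≤ (ℓ₁ ∩ (S : Set (ℝ × ℝ))).ncard ∧
            k ≤ (ℓ₂ ∩ (S : Set (ℝ × ℝ))).ncard}.ncard : ℝ) ≤ S.card := by
      rw [← Set.ncard_coe_finset S]
      refine Nat.cast_le.mpr (Set.ncard_le_ncard ?_ S.finite_toSet)
      exact fun ξ hξ => hξ.1
    refine hle.trans ?_
    have hkS' : (k : ℝ) ^ 2 ≤ 4 * S.card := by exact_mod_cast hkS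
    set n : ℝ := (S.card : ℝ)
    have hn : 0 ≤ n := Nat.cast_nonneg _
    have h6 : ((k : ℝ) ^ 2) ^ 3 ≤ (4 * n) ^ 3 := pow_le_pow_left₀ (by positivity) hkS' 3
    calc n ≤ 64 * (n ^ 2 / (k : ℝ) ^ 3) ^ 2 := by
          rw [div_pow, ← mul_div_assoc, le_div_iff₀ (by positivity)]
          calc n * ((k : ℝ) ^ 3) ^ 2 = n * ((k : ℝ) ^ 2) ^ 3 := by ring
            _ ≤ n * (4 * n) ^ 3 := mul_le_mul_of_nonneg_left h6 hn
            _ = 64 * (n ^ 2) ^ 2 := by ring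
      _ ≤ _ := by gcongr; exact le_add_of_nonneg_right (by positivity)
  · let T : Finset (Finset (ℝ × ℝ)) := S.powerset.filter fun A =>
      k ≤ A.card ∧ ∃ ℓ : Set (ℝ × ℝ), IsLine ℓ ∧ (A : Set (ℝ × ℝ)) = ℓ ∩ S
    have hTS : ∀ A ∈ T, A ⊆ S := fun A hA =>
      Finset.mem_powerset.mp (Finset.mem_filter.mp hA).1
    have hTk : ∀ A ∈ T, k ≤ A.card := fun A hA => (Finset.mem_filter.mp hA).2.1
    have hT : ∀ A ∈ T, ∀ B ∈ T, A ≠ B → (A ∩ B).card ≤ 1 := by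
      intro A hA B hB hAB
      obtain ⟨ℓ₁, h₁, hA'⟩ := (Finset.mem_filter.mp hA).2.2
      obtain ⟨ℓ₂, h₂, hB'⟩ := (Finset.mem_filter.mp hB).2.2
      have memA {x} (hx : x ∈ A) : x ∈ ℓ₁ := (hA' ▸ Finset.mem_coe.mpr hx : x ∈ ℓ₁ ∩ S).1
      have memB {x} (hx : x ∈ B) : x ∈ ℓ₂ := (hB' ▸ Finset.mem_coe.mpr hx : x ∈ ℓ₂ ∩ S).1
      refine Finset.card_le_one.mpr fun x hx y hy => ?_
      rw [Finset.mem_inter] at hx hy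
      by_contra hxy
      refine hAB (Finset.coe_injective ?_)
      rw [hA', hB',
        h₁.eq_of_two_points h₂ hxy (memA hx.1) (memB hx.2) (memA hy.1) (memB hy.2)]
    have trace {ℓ : Set (ℝ × ℝ)} (hℓ : IsLine ℓ) (hr : k ≤ (ℓ ∩ (S : Set (ℝ × ℝ))).ncard) :
        S.filter (· ∈ ℓ) ∈ T := by
      have hcoe : ((S.filter (· ∈ ℓ) : Finset (ℝ × ℝ)) : Set (ℝ × ℝ)) = ℓ ∩ S := by
        ext x; simp [and_comm]
      refine Finset.mem_filter.mpr ⟨Finset.mem_powerset.mpr (Finset.filter_subset _ _), ?_,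
        ℓ, hℓ, hcoe⟩
      rwa [← Set.ncard_coe_finset, hcoe]
    have hsub : {ξ : ℝ × ℝ | ξ ∈ S ∧ ∃ ℓ₁ ℓ₂ : Set (ℝ × ℝ),
            IsLine ℓ₁ ∧ IsLine ℓ₂ ∧ ℓ₁ ≠ ℓ₂ ∧ ξ ∈ ℓ₁ ∧ ξ ∈ ℓ₂ ∧
            k ≤ (ℓ₁ ∩ (S : Set (ℝ × ℝ))).ncard ∧
            k ≤ (ℓ₂ ∩ (S : Set (ℝ × ℝ))).ncard} ⊆
        (T.offDiag.biUnion fun P => P.1 ∩ P.2 : Finset (ℝ × ℝ)) := by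
      rintro ξ ⟨hξ, ℓ₁, ℓ₂, h₁, h₂, hne, hξ₁, hξ₂, hr₁, hr₂⟩
      refine Finset.mem_coe.mpr (Finset.mem_biUnion.mpr
        ⟨(S.filter (· ∈ ℓ₁), S.filter (· ∈ ℓ₂)), Finset.mem_offDiag.mpr
          ⟨trace h₁ hr₁, trace h₂ hr₂, fun heq => hne ?_⟩, by simp [hξ, hξ₁, hξ₂]⟩)
      obtain ⟨x, hx, y, hy, hxy⟩ := Finset.one_lt_card.mp (hk.trans (hTk _ (trace h₁ hr₁)))
      have hx' := hx
      have hy' := hy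
      rw [show S.filter (· ∈ ℓ₁) = S.filter (· ∈ ℓ₂) from heq] at hx' hy'
      rw [Finset.mem_filter] at hx hy hx' hy'
      exact h₁.eq_of_two_points h₂ hxy hx.2 hx'.2 hy.2 hy'.2
    have hcard : (T.offDiag.biUnion fun P => P.1 ∩ P.2).card ≤ T.card ^ 2 := by
      refine (Finset.card_biUnion_le_card_mul _ _ 1 fun P hP => ?_).trans ?_
      · obtain ⟨hA, hB, hAB⟩ := Finset.mem_offDiag.mp hP
        exact hT _ hA _ hB hAB
      · rw [Finset.offDiag_card, mul_one, sq]
        exact Nat.sub_le _ _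
    have hncard := Set.ncard_le_ncard hsub (Finset.finite_toSet _)
    rw [Set.ncard_coe_finset] at hncard
    have hm := card_mul_le_of_card_inter_le_one S T k hTS hTk hT hkS
    calc _ ≤ (T.card : ℝ) ^ 2 := by exact_mod_cast hncard.trans hcard
      _ ≤ (2 * S.card / k) ^ 2 := by gcongr; rwa [le_div_iff₀ hk0]
      _ = 4 * ((S.card : ℝ) / k) ^ 2 := by ring
      _ ≤ 64 * ((S.card : ℝ) ^ 2 / (k : ℝ) ^ 3 + (S.card : ℝ) / (k : ℝ)) ^ 2 := by
        gcongr
        · norm_num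
        · exact le_add_of_nonneg_left (by positivity)
end

section
/- For every constant C ∈ ℕ there exists c > 0 such that the following holds. Let m ≥ 1, let S₀,…,S_m be disjoint subsets of ℤ² with #S_j ≤ 2^j for each j, let λ₀,…,λ_m ≥ 0, and let f = Σ_{j=0}^m λ_j 2^{−j/2} χ_{S_j}. Assume that for each j = 0,…,m and each ξ ∈ S_j there exists at most one line ℓ ⊂ ℝ² through ξ with #(ℓ ∩ S_j) ≥ 2^{j/2+C}. Then Σ_{Q ∈ 𝒬⁰} f(Q) ≤ c · m · (Σ_{j=0}^m λ_j²)². -/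
open scoped BigOperators

noncomputable section

/-- Points of the integer lattice `ℤ²`. -/
abbrev Pt := ℤ × ℤ

/-- A quadruple of lattice points, viewed as a function on `Fin 4`
(indices taken cyclically). -/
abbrev Quad := Fin 4 → Pt

/-- The embedding `ℤ² ↪ ℝ²`. -/
def emb (ξ : Pt) : ℝ × ℝ := ((ξ.1 : ℝ), (ξ.2 : ℝ))

/-- The line through two lattice points `p ≠ q` (a degenerate point if `p = q`). -/
def lineThrough (p q : Pt) : Set (ℝ × ℝ) :=
  {x | ∃ t : ℝ, x = emb p + t • (emb q - emb p)}

/-- The number of points of a finite set `T ⊂ ℤ²` on a set `ℓ ⊂ ℝ²`,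
i.e. `#(ℓ ∩ T)`. -/
def lineCount (ℓ : Set (ℝ × ℝ)) (T : Finset Pt) : ℕ :=
  (ℓ ∩ (emb '' (T : Set Pt))).ncard

/-- `Q = (ξ₁,ξ₂,ξ₃,ξ₄)` is a parallelogram: `ξ₁ + ξ₃ = ξ₂ + ξ₄`. -/
def IsPara (Q : Quad) : Prop := Q 0 + Q 2 = Q 1 + Q 3

/-- The dot product `(ξ₁ − ξ₂)·(ξ₁ − ξ₄)`. -/
def dotQ (Q : Quad) : ℤ :=
  ((Q 0).1 - (Q 1).1) * ((Q 0).1 - (Q 3).1) + ((Q 0).2 - (Q 1).2) * ((Q 0).2 - (Q 3).2)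

/-- `τ_Q = ||ξ₁|² − |ξ₂|² + |ξ₃|² − |ξ₄|²| = 2|(ξ₁−ξ₂)·(ξ₁−ξ₄)|`. -/
def tauQ (Q : Quad) : ℤ := 2 * |dotQ Q|

/-- `Q` is a rectangle: a parallelogram with `τ_Q = 0`. Membership in `𝒬⁰`. -/
def IsRect (Q : Quad) : Prop := IsPara Q ∧ dotQ Q = 0

/-- `f(Q) = f(ξ₁)f(ξ₂)f(ξ₃)f(ξ₄)`. -/
def fQ (f : Pt → ℝ) (Q : Quad) : ℝ := ∏ k : Fin 4, f (Q k)

/-- The weight `f = ∑_{j=0}^m λ_j 2^{−j/2} χ_{S_j}`. -/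
def fWt (S : ℕ → Finset Pt) (lam : ℕ → ℝ) (m : ℕ) (ξ : Pt) : ℝ :=
  ∑ j ∈ Finset.range (m + 1), if ξ ∈ S j then lam j * (2 : ℝ) ^ (-(j : ℝ) / 2) else 0

/-- `gcd((a,b)) = gcd(|a|,|b|)` for `(a,b) ∈ ℤ²`. -/
def gcdP (ξ : Pt) : ℕ := Int.gcd ξ.1 ξ.2

/-- `max{#(ℓ(ξ,η₁) ∩ S_j), #(ℓ(ξ,η₂) ∩ S_j)}`, where `η₁, η₂` are the two
neighboring vertices of `ξ` in a rectangle. -/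
def crossMax (S : ℕ → Finset Pt) (j : ℕ) (ξ η₁ η₂ : Pt) : ℕ :=
  max (lineCount (lineThrough ξ η₁) (S j)) (lineCount (lineThrough ξ η₂) (S j))

/-- `ξ` lies in some `S_j`, `j ≤ m`, and is a vertex of type `α ∈ {1,2,3}`
relative to its neighbors `η₁, η₂`: with `a := log₂ crossMax`, type 1 means
`a ≥ j/2 + C` (i.e. `crossMax ≥ 2^{j/2+C}`), type 2 means `1 ≤ a < j/2 + C`
(i.e. `2 ≤ crossMax < 2^{j/2+C}`), and type 3 means `a = 0` (`crossMax = 1`). -/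
def VertexType (S : ℕ → Finset Pt) (C m : ℕ) (α : ℕ) (ξ η₁ η₂ : Pt) : Prop :=
  ∃ j ≤ m, ξ ∈ S j ∧
    ((α = 1 ∧ (2 : ℝ) ^ ((j : ℝ) / 2 + (C : ℝ)) ≤ (crossMax S j ξ η₁ η₂ : ℝ)) ∨
     (α = 2 ∧ 2 ≤ crossMax S j ξ η₁ η₂ ∧
        (crossMax S j ξ η₁ η₂ : ℝ) < (2 : ℝ) ^ ((j : ℝ) / 2 + (C : ℝ))) ∨
     (α = 3 ∧ crossMax S j ξ η₁ η₂ = 1))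

/-- The set `𝒬⁰_{α,β}`: rectangles with four distinct vertices, all in
`∪_{j=0}^m S_j`, with `ξ₁, ξ₂` of type `α` and `ξ₃, ξ₄` of type `β`. -/
def QZeroAB (S : ℕ → Finset Pt) (C m : ℕ) (α β : ℕ) : Set Quad :=
  {Q | IsRect Q ∧ Function.Injective Q ∧
    VertexType S C m α (Q 0) (Q 1) (Q 3) ∧
    VertexType S C m α (Q 1) (Q 2) (Q 0) ∧
    VertexType S C m β (Q 2) (Q 3) (Q 1) ∧
    VertexType S C m β (Q 3) (Q 0) (Q 2)}

/-- The set `𝒬⁰(j⃗, a⃗)`: rectangles with distinct vertices `ξ_k ∈ S_{j_k}` such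
that for each `k` (cyclically), `2^{a_k} ≤ max{#(ℓ(ξ_k,ξ_{k+1}) ∩ S_{j_k}),
#(ℓ(ξ_k,ξ_{k−1}) ∩ S_{j_k})} < 2^{a_k+1}`. -/
def QZeroJA (S : ℕ → Finset Pt) (j a : Fin 4 → ℕ) : Set Quad :=
  {Q | IsRect Q ∧ Function.Injective Q ∧ (∀ k, Q k ∈ S (j k)) ∧
    ∀ k : Fin 4,
      2 ^ (a k) ≤ max (lineCount (lineThrough (Q k) (Q (k + 1))) (S (j k)))
          (lineCount (lineThrough (Q k) (Q (k - 1))) (S (j k))) ∧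
        max (lineCount (lineThrough (Q k) (Q (k + 1))) (S (j k)))
          (lineCount (lineThrough (Q k) (Q (k - 1))) (S (j k))) < 2 ^ (a k + 1)}

/-- The slope of the segment joining the endpoints of `e`. -/
def edgeSlope (e : Pt × Pt) : ℚ := ((e.2.2 : ℚ) - e.1.2) / ((e.2.1 : ℚ) - e.1.1)

/-- The height above `x` of the line spanned by the non-vertical segment `e`. -/
def edgeHeight (e : Pt × Pt) (x : ℚ) : ℚ := e.1.2 + edgeSlope e * (x - e.1.1)

/-- Two non-vertical segments meet at a point interior to both of them. -/
def Crosses (e g : Pt × Pt) : Prop :=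
  ∃ x : ℚ, (e.1.1 : ℚ) < x ∧ (g.1.1 : ℚ) < x ∧ x < e.2.1 ∧ x < g.2.1 ∧
    edgeHeight e x = edgeHeight g x

lemma edgeHeight_left (e : Pt × Pt) : edgeHeight e e.1.1 = e.1.2 := by
  simp [edgeHeight]

lemma edgeHeight_right {e : Pt × Pt} (h : e.1.1 < e.2.1) : edgeHeight e e.2.1 = e.2.2 := by
  have h' : (e.1.1 : ℚ) < e.2.1 := by exact_mod_cast h
  have : (e.2.1 : ℚ) - e.1.1 ≠ 0 := by linarith
  unfold edgeHeight edgeSlope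
  field_simp
  ring

lemma edgeHeight_sub (e : Pt × Pt) (x y : ℚ) :
    edgeHeight e y - edgeHeight e x = edgeSlope e * (y - x) := by
  unfold edgeHeight; ring

/-- Two lines whose order differs at `u` and at `v` meet strictly in between. -/
lemma exists_edgeHeight_eq {e g : Pt × Pt} {u v : ℚ} (huv : u < v)
    (hu : edgeHeight g u < edgeHeight e u) (hv : edgeHeight e v < edgeHeight g v) :
    ∃ x, u < x ∧ x < v ∧ edgeHeight e x = edgeHeight g x := by
  have h1 := edgeHeight_sub e u v
  have h2 := edgeHeight_sub g u v
  have hs : 0 < edgeSlope g - edgeSlope e := by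
    by_contra hcon
    push Not at hcon
    nlinarith
  set D := edgeHeight e u - edgeHeight g u with hD
  refine ⟨u + D / (edgeSlope g - edgeSlope e), ?_, ?_, ?_⟩
  · have : 0 < D / (edgeSlope g - edgeSlope e) := div_pos (by linarith) hs
    linarith
  · have : D / (edgeSlope g - edgeSlope e) < v - u := by
      rw [div_lt_iff₀ hs]; nlinarith
    linarith
  · have h3 := edgeHeight_sub e u (u + D / (edgeSlope g - edgeSlope e))
    have h4 := edgeHeight_sub g u (u + D / (edgeSlope g - edgeSlope e))
    have h5 : D / (edgeSlope g - edgeSlope e) * (edgeSlope g - edgeSlope e) = D :=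
      div_mul_cancel₀ _ hs.ne'
    nlinarith

/-- A plane straight-line graph with vertex set `A` and set of non-vertical edges `E`, each
edge being listed with its left endpoint first. -/
structure IsPlaneGraph (A : Finset Pt) (E : Finset (Pt × Pt)) : Prop where
  mem : ∀ e ∈ E, e.1 ∈ A ∧ e.2 ∈ A ∧ e.1.1 < e.2.1
  interior : ∀ e ∈ E, ∀ w ∈ A, e.1.1 < w.1 → w.1 < e.2.1 → edgeHeight e w.1 ≠ w.2
  noncrossing : ∀ e ∈ E, ∀ g ∈ E, e ≠ g → ¬ Crosses e g

/-- The vertex `w` lies in the closed wedge between `e` and `e'`, two edges with the same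
left endpoint. -/
def InWedge (e e' : Pt × Pt) (w : Pt) : Prop :=
  e.1.1 < w.1 ∧ w.1 ≤ e.2.1 ∧ w.1 ≤ e'.2.1 ∧ edgeHeight e w.1 ≤ w.2 ∧ (w.2 : ℚ) ≤ edgeHeight e' w.1

/-- `e'` is the next edge above `e` at the left endpoint of `e`, and `w` is the leftmost, and
then lowest, vertex of the wedge between them. -/
structure IsFirstInWedge (A : Finset Pt) (E : Finset (Pt × Pt)) (e e' : Pt × Pt) (w : Pt) :
    Prop where
  mem_left : e ∈ E
  mem_right : e' ∈ E
  left_eq : e'.1 = e.1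
  slope_lt : edgeSlope e < edgeSlope e'
  next : ∀ g ∈ E, g.1 = e.1 → edgeSlope e < edgeSlope g → edgeSlope e' ≤ edgeSlope g
  mem : w ∈ A
  inWedge : InWedge e e' w
  first : ∀ v ∈ A, InWedge e e' v → w.1 < v.1 ∨ (w.1 = v.1 ∧ w.2 ≤ v.2)

lemma exists_isFirstInWedge {A : Finset Pt} {E : Finset (Pt × Pt)} (h : IsPlaneGraph A E)
    {e : Pt × Pt} (he : e ∈ E) (htop : ∃ g ∈ E, g.1 = e.1 ∧ edgeSlope e < edgeSlope g) :
    ∃ e' w, IsFirstInWedge A E e e' w := by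
  classical
  obtain ⟨e', he', hmin⟩ := Finset.exists_min_image
    (E.filter fun g => g.1 = e.1 ∧ edgeSlope e < edgeSlope g) edgeSlope
    (by obtain ⟨g, hg, h1⟩ := htop; exact ⟨g, by simp [hg, h1]⟩)
  simp only [Finset.mem_filter] at he' hmin
  obtain ⟨he'E, hl, hs⟩ := he'
  obtain ⟨heA, heA2, helt⟩ := h.mem e he
  obtain ⟨he'A, he'A2, he'lt⟩ := h.mem e' he'E
  have hmono : ∀ x : ℚ, (e.1.1 : ℚ) < x → edgeHeight e x ≤ edgeHeight e' x := by
    intro x hx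
    unfold edgeHeight
    rw [hl]
    nlinarith
  have hne : (A.filter fun v => InWedge e e' v).Nonempty := by
    rcases le_total e.2.1 e'.2.1 with h1 | h1
    · refine ⟨e.2, ?_⟩
      simp only [Finset.mem_filter]
      refine ⟨heA2, helt, le_rfl, h1, (edgeHeight_right helt).le, ?_⟩
      rw [← edgeHeight_right helt]
      exact hmono _ (by exact_mod_cast helt)
    · refine ⟨e'.2, ?_⟩
      simp only [Finset.mem_filter]
      refine ⟨he'A2, hl ▸ he'lt, h1, le_rfl, ?_, (edgeHeight_right he'lt).ge⟩
      rw [← edgeHeight_right he'lt]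
      exact hmono _ (by rw [hl] at he'lt; exact_mod_cast he'lt)
  obtain ⟨w, hw, hwmin⟩ := Finset.exists_min_image _ (fun v : Pt => toLex v) hne
  simp only [Finset.mem_filter] at hw hwmin
  refine ⟨e', w, he, he'E, hl, hs, fun g hg h1 h2 => hmin g ⟨hg, h1, h2⟩, hw.1, hw.2, ?_⟩
  intro v hv hv'
  have := hwmin v ⟨hv, hv'⟩
  rw [Prod.Lex.le_iff] at this
  simpa using this

namespace IsFirstInWedge

variable {A : Finset Pt} {E : Finset (Pt × Pt)} {e e' g : Pt × Pt} {w : Pt}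

/-- An edge passing between `e` and `e'` to the left of `w` starts at their common vertex. -/
lemma left_eq_of_between (hf : IsFirstInWedge A E e e' w) (h : IsPlaneGraph A E) (hg : g ∈ E)
    (hlw : g.1.1 < w.1) (hwr : w.1 ≤ g.2.1)
    (h1 : edgeHeight e (max g.1.1 e.1.1 : ℤ) ≤ edgeHeight g (max g.1.1 e.1.1 : ℤ))
    (h2 : edgeHeight g (max g.1.1 e.1.1 : ℤ) ≤ edgeHeight e' (max g.1.1 e.1.1 : ℤ)) :
    g.1 = e.1 := by
  rcases lt_or_ge e.1.1 g.1.1 with hc | hc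
  · rw [max_eq_left hc.le] at h1 h2
    rw [edgeHeight_left] at h1 h2
    obtain ⟨_, hw1, hw2, _, _⟩ := hf.inWedge
    rcases hf.first g.1 (h.mem g hg).1 ⟨hc, by omega, by omega, h1, h2⟩ with h3 | h3 <;> omega
  · rw [max_eq_right hc] at h1 h2
    have h3 : edgeHeight e' e.1.1 = e.1.2 := by rw [← hf.left_eq, edgeHeight_left]
    rw [edgeHeight_left] at h1
    rw [h3] at h2
    have h4 : edgeHeight g e.1.1 = e.1.2 := le_antisymm h2 h1
    rcases hc.lt_or_eq with hc | hc
    · exact absurd h4 (h.interior g hg e.1 (h.mem e hf.mem_left).1 hc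
        (lt_of_lt_of_le hf.inWedge.1 hwr))
    · rw [← hc, edgeHeight_left] at h4
      exact Prod.ext hc (by exact_mod_cast h4)

lemma eq_of_not_crosses_above (hf : IsFirstInWedge A E e e' w) (h : IsPlaneGraph A E) (hg : g ∈ E)
    (hlw : g.1.1 < w.1) (hwr : w.1 ≤ g.2.1) (h1 : edgeHeight e w.1 ≤ edgeHeight g w.1)
    (h2 : edgeHeight g w.1 < w.2) : g = e := by
  by_contra hne
  obtain ⟨hw0, hw1, hw2, hw3, hw4⟩ := hf.inWedge
  obtain ⟨heA, heA2, helt⟩ := h.mem e hf.mem_left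
  obtain ⟨hgA, hgA2, hglt⟩ := h.mem g hg
  have hlt1 : w.1 < e.2.1 := by
    refine lt_of_le_of_ne hw1 fun hcon => ?_
    have h3 : edgeHeight e w.1 = e.2.2 := by rw [hcon]; exact edgeHeight_right helt
    have h4 : (e.2.2 : ℚ) < w.2 := by linarith
    have h4' : e.2.2 < w.2 := by exact_mod_cast h4
    have h5 : InWedge e e' e.2 := by
      refine ⟨helt, le_rfl, by omega, (edgeHeight_right helt).le, ?_⟩
      rw [← hcon]; linarith
    rcases hf.first _ heA2 h5 with h6 | h6 <;> omega
  have hlt2 : w.1 < g.2.1 := by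
    refine lt_of_le_of_ne hwr fun hcon => ?_
    have h3 : edgeHeight g w.1 = g.2.2 := by rw [hcon]; exact edgeHeight_right hglt
    have h4 : (g.2.2 : ℚ) < w.2 := by linarith
    have h4' : g.2.2 < w.2 := by exact_mod_cast h4
    have h5 : InWedge e e' g.2 := by
      refine ⟨by omega, by omega, by omega, ?_, ?_⟩
      · rw [← hcon]; linarith
      · rw [← hcon]; linarith
    rcases hf.first _ hgA2 h5 with h6 | h6 <;> omega
  have cast_lt : ∀ {a b : ℤ}, a < b → (a : ℚ) < b := fun h => by exact_mod_cast h
  have h1' : edgeHeight e w.1 < edgeHeight g w.1 := by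
    refine lt_of_le_of_ne h1 fun hcon => ?_
    exact h.noncrossing e hf.mem_left g hg (Ne.symm hne)
      ⟨w.1, cast_lt hw0, cast_lt hlw, cast_lt hlt1, cast_lt hlt2, hcon⟩
  have h2' : edgeHeight g w.1 < edgeHeight e' w.1 := by linarith
  have hge' : g ≠ e' := fun hcon => by rw [hcon] at h2'; exact lt_irrefl _ h2'
  have hmax : ((max g.1.1 e.1.1 : ℤ) : ℚ) < w.1 := cast_lt (max_lt hlw hw0)
  have hleft : g.1 = e.1 := by
    refine hf.left_eq_of_between h hg hlw hwr ?_ ?_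
    · by_contra hcon
      push Not at hcon
      obtain ⟨x, hx1, hx2, hx3⟩ := exists_edgeHeight_eq hmax hcon h1'
      have ha : (g.1.1 : ℚ) ≤ (max g.1.1 e.1.1 : ℤ) := by exact_mod_cast le_max_left _ _
      have hb : (e.1.1 : ℚ) ≤ (max g.1.1 e.1.1 : ℤ) := by exact_mod_cast le_max_right _ _
      exact h.noncrossing e hf.mem_left g hg (Ne.symm hne)
        ⟨x, by linarith, by linarith, by linarith [cast_lt hlt1], by linarith [cast_lt hlt2], hx3⟩
    · by_contra hcon
      push Not at hcon
      obtain ⟨x, hx1, hx2, hx3⟩ := exists_edgeHeight_eq hmax hcon h2'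
      have ha : (g.1.1 : ℚ) ≤ (max g.1.1 e.1.1 : ℤ) := by exact_mod_cast le_max_left _ _
      have hb : (e.1.1 : ℚ) ≤ (max g.1.1 e.1.1 : ℤ) := by exact_mod_cast le_max_right _ _
      have hw2' : (w.1 : ℚ) ≤ e'.2.1 := by exact_mod_cast hw2
      refine h.noncrossing g hg e' hf.mem_right hge'
        ⟨x, by linarith, ?_, by linarith [cast_lt hlt2], by linarith, hx3⟩
      rw [hf.left_eq]; linarith
  have hs1 : edgeSlope e < edgeSlope g := by
    have := cast_lt hw0
    unfold edgeHeight at h1'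
    rw [hleft] at h1'
    nlinarith
  have hs2 : edgeSlope g < edgeSlope e' := by
    have := cast_lt hw0
    unfold edgeHeight at h2'
    rw [hleft, hf.left_eq] at h2'
    nlinarith
  linarith [hf.next g hg hleft hs1]

lemma right_eq (hf : IsFirstInWedge A E e e' w) (h : IsPlaneGraph A E)
    (hw : edgeHeight e w.1 = w.2) : e.2 = w := by
  obtain ⟨hw0, hw1, hw2, hw3, hw4⟩ := hf.inWedge
  obtain ⟨heA, heA2, helt⟩ := h.mem e hf.mem_left
  rcases hw1.lt_or_eq with h1 | h1
  · exact absurd hw (h.interior e hf.mem_left w hf.mem hw0 h1)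
  · rw [h1, edgeHeight_right helt] at hw
    exact Prod.ext h1.symm (by exact_mod_cast hw)

lemma eq_of_right_eq (hf : IsFirstInWedge A E e e' w) (h : IsPlaneGraph A E) (hg : g ∈ E)
    (hew : e.2 = w) (hgw : g.2 = w) (hs : edgeSlope g ≤ edgeSlope e) : g = e := by
  obtain ⟨hw0, hw1, hw2, hw3, hw4⟩ := hf.inWedge
  obtain ⟨heA, heA2, helt⟩ := h.mem e hf.mem_left
  obtain ⟨hgA, hgA2, hglt⟩ := h.mem g hg
  have cast_lt : ∀ {a b : ℤ}, a < b → (a : ℚ) < b := fun h => by exact_mod_cast h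
  have hlw : g.1.1 < w.1 := hgw ▸ hglt
  have hmax : ((max g.1.1 e.1.1 : ℤ) : ℚ) < w.1 := cast_lt (max_lt hlw hw0)
  have he : edgeHeight e w.1 = w.2 := by rw [← hew]; exact edgeHeight_right helt
  have hgh : edgeHeight g w.1 = w.2 := by rw [← hgw]; exact edgeHeight_right hglt
  have h2' : edgeHeight g w.1 < edgeHeight e' w.1 := by
    rw [hgh, ← he]
    have := cast_lt hw0
    have := hf.slope_lt
    unfold edgeHeight
    rw [hf.left_eq]
    nlinarith
  have hge' : g ≠ e' := fun hcon => by rw [hcon] at h2'; exact lt_irrefl _ h2'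
  have hleft : g.1 = e.1 := by
    refine hf.left_eq_of_between h hg hlw (by rw [hgw]) ?_ ?_
    · have h3 := edgeHeight_sub e (max g.1.1 e.1.1 : ℤ) w.1
      have h4 := edgeHeight_sub g (max g.1.1 e.1.1 : ℤ) w.1
      nlinarith
    · by_contra hcon
      push Not at hcon
      obtain ⟨x, hx1, hx2, hx3⟩ := exists_edgeHeight_eq hmax hcon h2'
      have ha : (g.1.1 : ℚ) ≤ (max g.1.1 e.1.1 : ℤ) := by exact_mod_cast le_max_left _ _
      have hb : (e.1.1 : ℚ) ≤ (max g.1.1 e.1.1 : ℤ) := by exact_mod_cast le_max_right _ _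
      have hw2' : (w.1 : ℚ) ≤ e'.2.1 := by exact_mod_cast hw2
      refine h.noncrossing g hg e' hf.mem_right hge'
        ⟨x, by linarith, ?_, by rw [hgw]; linarith, by linarith, hx3⟩
      rw [hf.left_eq]; linarith
  exact Prod.ext hleft (hgw.trans hew.symm)

end IsFirstInWedge

lemma eq_of_slope_eq {A : Finset Pt} {E : Finset (Pt × Pt)} (h : IsPlaneGraph A E)
    {e g : Pt × Pt} (he : e ∈ E) (hg : g ∈ E) (hl : e.1 = g.1) (hs : edgeSlope e = edgeSlope g) :
    e = g := by
  by_contra hne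
  obtain ⟨-, -, helt⟩ := h.mem e he
  obtain ⟨-, -, hglt⟩ := h.mem g hg
  obtain ⟨x, hx1, hx2⟩ := exists_between
    (show (e.1.1 : ℚ) < ((min e.2.1 g.2.1 : ℤ) : ℚ) by
      rw [hl] at helt
      rw [hl]
      exact_mod_cast lt_min helt hglt)
  push_cast at hx2
  rw [lt_min_iff] at hx2
  refine h.noncrossing e he g hg hne ⟨x, hx1, hl ▸ hx1, hx2.1, hx2.2, ?_⟩
  unfold edgeHeight
  rw [hl, hs]

/-- A plane straight-line graph on `n` vertices has at most `3n` non-vertical edges. -/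
theorem IsPlaneGraph.card_le {A : Finset Pt} {E : Finset (Pt × Pt)} (h : IsPlaneGraph A E) :
    E.card ≤ 3 * A.card := by
  classical
  set T := E.filter fun e => ∃ g ∈ E, g.1 = e.1 ∧ edgeSlope e < edgeSlope g with hT
  have hex : ∀ e : Pt × Pt, ∃ ew : (Pt × Pt) × Pt, e ∈ T → IsFirstInWedge A E e ew.1 ew.2 := by
    intro e
    by_cases he : e ∈ T
    · rw [hT, Finset.mem_filter] at he
      obtain ⟨e', w, hw⟩ := exists_isFirstInWedge h he.1 he.2
      exact ⟨(e', w), fun _ => hw⟩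
    · exact ⟨(e, e.1), fun h => absurd h he⟩
  choose F hF using hex
  have h1 : (E \ T).card ≤ A.card := by
    refine Finset.card_le_card_of_injOn (fun e => e.1) ?_ ?_
    · intro e he
      simp only [Finset.coe_sdiff, Set.mem_sdiff, Finset.mem_coe] at he
      exact (h.mem e he.1).1
    · intro e he g hg heg
      simp only [Finset.coe_sdiff, Set.mem_sdiff, Finset.mem_coe, hT, Finset.mem_filter,
        not_and, not_exists, not_lt] at he hg
      have heg' : e.1 = g.1 := heg
      exact eq_of_slope_eq h he.1 hg.1 heg' (le_antisymm
        (hg.2 hg.1 e he.1 heg') (he.2 he.1 g hg.1 heg'.symm))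
  have h2 : (T.filter fun e => edgeHeight e (F e).2.1 = (F e).2.2).card ≤ A.card := by
    refine Finset.card_le_card_of_injOn (fun e => (F e).2) ?_ ?_
    · intro e he
      simp only [Finset.coe_filter, Set.mem_ofPred_eq] at he
      exact (hF e he.1).mem
    · intro e he g hg heg
      simp only [Finset.coe_filter, Set.mem_ofPred_eq] at he hg
      have heg' : (F e).2 = (F g).2 := heg
      have he2 := (hF e he.1).right_eq h he.2
      have hg2 := (hF g hg.1).right_eq h hg.2
      rcases le_total (edgeSlope g) (edgeSlope e) with hs | hs
      · exact ((hF e he.1).eq_of_right_eq h (hF g hg.1).mem_left he2 (hg2.trans heg'.symm) hs).symm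
      · exact (hF g hg.1).eq_of_right_eq h (hF e he.1).mem_left hg2 (he2.trans heg') hs
  have h3 : (T.filter fun e => ¬ edgeHeight e (F e).2.1 = (F e).2.2).card ≤ A.card := by
    refine Finset.card_le_card_of_injOn (fun e => (F e).2) ?_ ?_
    · intro e he
      simp only [Finset.coe_filter, Set.mem_ofPred_eq] at he
      exact (hF e he.1).mem
    · intro e he g hg heg
      simp only [Finset.coe_filter, Set.mem_ofPred_eq] at he hg
      have heg' : (F e).2 = (F g).2 := heg
      have e1 := hF e he.1
      have g1 := hF g hg.1
      have e2 : edgeHeight e (F e).2.1 < (F e).2.2 := lt_of_le_of_ne e1.inWedge.2.2.2.1 he.2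
      have g2 : edgeHeight g (F g).2.1 < (F g).2.2 := lt_of_le_of_ne g1.inWedge.2.2.2.1 hg.2
      have e3 := e1.inWedge
      have g3 := g1.inWedge
      rw [← heg'] at g2 g3 g1
      rcases le_total (edgeHeight e (F e).2.1) (edgeHeight g (F e).2.1) with hs | hs
      · exact (e1.eq_of_not_crosses_above h g1.mem_left g3.1 g3.2.1 hs g2).symm
      · exact g1.eq_of_not_crosses_above h e1.mem_left e3.1 e3.2.1 hs e2
  have h4 := Finset.card_filter_add_card_filter_not (s := T)
    (fun e => edgeHeight e (F e).2.1 = (F e).2.2)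
  have h5 : (E \ T).card + T.card = E.card :=
    Finset.card_sdiff_add_card_eq_card (Finset.filter_subset _ _)
  omega

/-- The probability of the subset `A` of `S` when points are kept independently with
probability `p`. -/
def subsetWeight (p : ℝ) (S A : Finset Pt) : ℝ := (∏ _i ∈ A, p) * ∏ _i ∈ S \ A, (1 - p)

lemma subsetWeight_nonneg {p : ℝ} (h0 : 0 ≤ p) (h1 : p ≤ 1) (S A : Finset Pt) :
    0 ≤ subsetWeight p S A :=
  mul_nonneg (Finset.prod_nonneg fun _ _ => h0)
    (Finset.prod_nonneg fun _ _ => sub_nonneg.2 h1)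

open Classical in
lemma sum_subsetWeight_of_subset (p : ℝ) {S T : Finset Pt} (hT : T ⊆ S) :
    ∑ A ∈ S.powerset, subsetWeight p S A * (if T ⊆ A then 1 else 0) = p ^ T.card := by
  have h := Finset.prod_add (fun _ : Pt => p) (fun i => if i ∈ T then 0 else 1 - p) S
  have hl : ∏ i ∈ S, (p + if i ∈ T then 0 else 1 - p) = p ^ T.card := by
    have : ∀ i ∈ S, (p + if i ∈ T then 0 else 1 - p) = if i ∈ T then p else 1 := by
      intro i _; split_ifs <;> ring
    rw [Finset.prod_congr rfl this, Finset.prod_ite, Finset.prod_const, Finset.prod_const_one,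
      mul_one, Finset.filter_mem_eq_inter, Finset.inter_eq_right.2 hT]
  rw [← hl, h]
  refine Finset.sum_congr rfl fun A hA => ?_
  unfold subsetWeight
  split_ifs with hTA
  · rw [mul_one]
    congr 1
    refine Finset.prod_congr rfl fun i hi => ?_
    rw [if_neg fun hiT => (Finset.mem_sdiff.1 hi).2 (hTA hiT)]
  · obtain ⟨i, hiT, hiA⟩ := Finset.not_subset.1 hTA
    rw [mul_zero, Finset.prod_eq_zero (Finset.mem_sdiff.2 ⟨hT hiT, hiA⟩) (by rw [if_pos hiT]),
      mul_zero]

open Classical in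
lemma sum_subsetWeight_mul_card {ι : Type*} (p : ℝ) (S : Finset Pt) (I : Finset ι)
    (T : ι → Finset Pt) (n : ℕ) (hT : ∀ i ∈ I, T i ⊆ S ∧ (T i).card = n) :
    ∑ A ∈ S.powerset, subsetWeight p S A * ((I.filter fun i => T i ⊆ A).card : ℝ) =
      p ^ n * I.card := by
  have : ∀ A ∈ S.powerset, subsetWeight p S A * ((I.filter fun i => T i ⊆ A).card : ℝ) =
      ∑ i ∈ I, subsetWeight p S A * (if T i ⊆ A then 1 else 0) := by
    intro A _
    rw [← Finset.mul_sum, Finset.card_filter]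
    push_cast
    rfl
  rw [Finset.sum_congr rfl this, Finset.sum_comm,
    Finset.sum_congr rfl fun i hi => (sum_subsetWeight_of_subset p (hT i hi).1).trans
      (by rw [(hT i hi).2])]
  rw [Finset.sum_const, nsmul_eq_mul, mul_comm]

open Classical in
/-- The ordered pairs of distinct crossing edges. -/
def crossingPairs (E : Finset (Pt × Pt)) : Finset ((Pt × Pt) × (Pt × Pt)) :=
  (E ×ˢ E).filter fun x => x.1 ≠ x.2 ∧ Crosses x.1 x.2

/-- A straight-line graph with `n` vertices has at most `3n` edges more than crossings. -/
lemma card_edges_le_add_crossings {A : Finset Pt} {E : Finset (Pt × Pt)}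
    (hmem : ∀ e ∈ E, e.1 ∈ A ∧ e.2 ∈ A ∧ e.1.1 < e.2.1)
    (hint : ∀ e ∈ E, ∀ w ∈ A, e.1.1 < w.1 → w.1 < e.2.1 → edgeHeight e w.1 ≠ w.2) :
    E.card ≤ 3 * A.card + (crossingPairs E).card := by
  classical
  set B := (crossingPairs E).image Prod.fst with hB
  have h : IsPlaneGraph A (E \ B) := by
    refine ⟨fun e he => hmem e (Finset.mem_sdiff.1 he).1,
      fun e he => hint e (Finset.mem_sdiff.1 he).1, fun e he g hg hne hc => ?_⟩
    rw [Finset.mem_sdiff] at he hg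
    refine he.2 (Finset.mem_image.2 ⟨(e, g), ?_, rfl⟩)
    simp only [crossingPairs, Finset.mem_filter, Finset.mem_product]
    exact ⟨⟨he.1, hg.1⟩, hne, hc⟩
  have h1 := h.card_le
  have h2 : B.card ≤ (crossingPairs E).card := Finset.card_image_le
  have h3 : E.card ≤ (E \ B).card + B.card := by
    have := Finset.le_card_sdiff B E
    omega
  omega

/-- The crossing lemma for straight-line graphs in which crossing edges have no endpoint in
common. -/
theorem crossing_lemma {S : Finset Pt} {E : Finset (Pt × Pt)}
    (hmem : ∀ e ∈ E, e.1 ∈ S ∧ e.2 ∈ S ∧ e.1.1 < e.2.1)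
    (hint : ∀ e ∈ E, ∀ w ∈ S, e.1.1 < w.1 → w.1 < e.2.1 → edgeHeight e w.1 ≠ w.2)
    (hends : ∀ x ∈ crossingPairs E, ({x.1.1, x.1.2, x.2.1, x.2.2} : Finset Pt).card = 4) :
    E.card ≤ 6 * S.card ∨ E.card ^ 3 ≤ 72 * S.card ^ 2 * (crossingPairs E).card := by
  classical
  rw [or_iff_not_imp_left, not_le]
  intro hlt
  have key : ∀ p : ℝ, 0 < p → p ≤ 1 →
      p ^ 2 * E.card ≤ 3 * (p * S.card) + p ^ 4 * (crossingPairs E).card := by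
    intro p hp0 hp1
    have e1 := sum_subsetWeight_mul_card p S E (fun e => {e.1, e.2}) 2 (by
      intro e he
      obtain ⟨h1, h2, h3⟩ := hmem e he
      refine ⟨by simp [Finset.insert_subset_iff, h1, h2], Finset.card_pair ?_⟩
      intro h; rw [h] at h3; exact lt_irrefl _ h3)
    have e2 := sum_subsetWeight_mul_card p S S (fun v => {v}) 1 (by simp)
    have e3 := sum_subsetWeight_mul_card p S (crossingPairs E)
      (fun x => {x.1.1, x.1.2, x.2.1, x.2.2}) 4 (by
        intro x hx
        refine ⟨?_, hends x hx⟩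
        simp only [crossingPairs, Finset.mem_filter, Finset.mem_product] at hx
        obtain ⟨h1, h2, -⟩ := hmem _ hx.1.1
        obtain ⟨h3, h4, -⟩ := hmem _ hx.1.2
        simp [Finset.insert_subset_iff, h1, h2, h3, h4])
    rw [pow_one] at e2
    rw [← e1, ← e2, ← e3, Finset.mul_sum, ← Finset.sum_add_distrib]
    refine Finset.sum_le_sum fun A hA => ?_
    have hAS : A ⊆ S := Finset.mem_powerset.1 hA
    have h := card_edges_le_add_crossings (A := A)
      (E := E.filter fun e => ({e.1, e.2} : Finset Pt) ⊆ A) (by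
        intro e he
        simp only [Finset.mem_filter, Finset.insert_subset_iff, Finset.singleton_subset_iff] at he
        exact ⟨he.2.1, he.2.2, (hmem e he.1).2.2⟩)
      (fun e he w hw => hint e (Finset.mem_filter.1 he).1 w (hAS hw))
    have hv : (S.filter fun v => ({v} : Finset Pt) ⊆ A).card = A.card := by
      congr 1
      ext v
      simp only [Finset.mem_filter, Finset.singleton_subset_iff]
      exact ⟨fun h => h.2, fun h => ⟨hAS h, h⟩⟩
    have hc : (crossingPairs (E.filter fun e => ({e.1, e.2} : Finset Pt) ⊆ A)).card =
        ((crossingPairs E).filter fun x =>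
          ({x.1.1, x.1.2, x.2.1, x.2.2} : Finset Pt) ⊆ A).card := by
      congr 1
      ext x
      simp only [crossingPairs, Finset.mem_filter, Finset.mem_product, Finset.insert_subset_iff,
        Finset.singleton_subset_iff]
      tauto
    rw [hc] at h
    rw [hv]
    have hw := subsetWeight_nonneg hp0.le hp1 S A
    have h' : ((E.filter fun e => ({e.1, e.2} : Finset Pt) ⊆ A).card : ℝ) ≤
        3 * A.card + ((crossingPairs E).filter fun x =>
          ({x.1.1, x.1.2, x.2.1, x.2.2} : Finset Pt) ⊆ A).card := by exact_mod_cast h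
    calc _ ≤ subsetWeight p S A * (3 * A.card + ((crossingPairs E).filter fun x =>
          ({x.1.1, x.1.2, x.2.1, x.2.2} : Finset Pt) ⊆ A).card) :=
          mul_le_mul_of_nonneg_left h' hw
      _ = _ := by ring
  have hE : (0 : ℝ) < E.card := by
    have : 0 < E.card := by omega
    exact_mod_cast this
  rcases Nat.eq_zero_or_pos S.card with hS | hS
  · rw [Finset.card_eq_zero] at hS
    have : E = ∅ := Finset.eq_empty_of_forall_notMem fun e he => by
      simpa [hS] using (hmem e he).1
    simp [this]
  have hS' : (0 : ℝ) < S.card := by exact_mod_cast hS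
  have hlt' : 6 * (S.card : ℝ) < E.card := by exact_mod_cast hlt
  have h := key (6 * S.card / E.card) (by positivity) (by rw [div_le_one hE]; exact hlt'.le)
  have h2 : (E.card : ℝ) ^ 3 ≤ 72 * S.card ^ 2 * (crossingPairs E).card := by
    field_simp at h
    ring_nf at h
    nlinarith
  exact_mod_cast h2

/-- The cross product of two lattice vectors. -/
def crossProd (d v : Pt) : ℤ := d.1 * v.2 - d.2 * v.1

/-- The points of `S` on the line through `ξ` with direction `d`. -/
def ptsOn (S : Finset Pt) (ξ d : Pt) : Finset Pt := S.filter fun p => crossProd d (p - ξ) = 0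

lemma mem_ptsOn {S : Finset Pt} {ξ d p : Pt} :
    p ∈ ptsOn S ξ d ↔ p ∈ S ∧ crossProd d (p - ξ) = 0 :=
  Finset.mem_filter

/-- The pairs of distinct points of `S` spanning a line with at least `k` and fewer than `2k`
points of `S`. -/
def richPairs (S : Finset Pt) (k : ℕ) : Finset (Pt × Pt) :=
  (S ×ˢ S).filter fun x => x.1 ≠ x.2 ∧ k ≤ (ptsOn S x.1 (x.2 - x.1)).card ∧
    (ptsOn S x.1 (x.2 - x.1)).card < 2 * k

/-- Slope and intercept of the non-vertical line spanned by `e`. -/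
def lineOf (e : Pt × Pt) : ℚ × ℚ := (edgeSlope e, edgeHeight e 0)

lemma edgeHeight_eq_of_lineOf_eq {e g : Pt × Pt} (h : lineOf e = lineOf g) :
    edgeHeight e = edgeHeight g := by
  funext x
  have h1 := edgeHeight_sub e 0 x
  have h2 := edgeHeight_sub g 0 x
  simp only [lineOf, Prod.mk.injEq] at h
  rw [h.1, h.2] at h1
  linarith

lemma lineOf_eq_of_edgeHeight_eq {e g : Pt × Pt} {x y : ℚ} (hxy : x ≠ y)
    (hx : edgeHeight e x = edgeHeight g x) (hy : edgeHeight e y = edgeHeight g y) :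
    lineOf e = lineOf g := by
  have h1 := edgeHeight_sub e x y
  have h2 := edgeHeight_sub g x y
  rw [hx, hy, h2] at h1
  have hs : edgeSlope e = edgeSlope g := (mul_right_cancel₀ (sub_ne_zero.2 hxy.symm) h1).symm
  have h3 := edgeHeight_sub e x 0
  have h4 := edgeHeight_sub g x 0
  rw [hs] at h3
  refine Prod.ext hs ?_
  change edgeHeight e 0 = edgeHeight g 0
  linarith

lemma edgeHeight_right' {e : Pt × Pt} (h : e.1.1 ≠ e.2.1) : edgeHeight e e.2.1 = e.2.2 := by
  have h' : (e.1.1 : ℚ) ≠ e.2.1 := by exact_mod_cast h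
  have : (e.2.1 : ℚ) - e.1.1 ≠ 0 := sub_ne_zero.2 h'.symm
  unfold edgeHeight edgeSlope
  field_simp
  ring

lemma lineOf_pair_eq {e : Pt × Pt} {p q : Pt} (hpq : p.1 ≠ q.1) (hp : edgeHeight e p.1 = p.2)
    (hq : edgeHeight e q.1 = q.2) : lineOf (p, q) = lineOf e := by
  refine lineOf_eq_of_edgeHeight_eq (x := p.1) (y := q.1) (by exact_mod_cast hpq) ?_ ?_
  · rw [hp]; exact edgeHeight_left (p, q)
  · rw [hq]; exact edgeHeight_right' (e := (p, q)) hpq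

lemma edgeHeight_eq_iff {e : Pt × Pt} (h : e.1.1 ≠ e.2.1) (w : Pt) :
    edgeHeight e w.1 = w.2 ↔ crossProd (e.2 - e.1) (w - e.1) = 0 := by
  have h' : (e.1.1 : ℚ) ≠ e.2.1 := by exact_mod_cast h
  have h2 : (e.2.1 : ℚ) - e.1.1 ≠ 0 := sub_ne_zero.2 h'.symm
  have : crossProd (e.2 - e.1) (w - e.1) = 0 ↔
      ((e.2.1 : ℚ) - e.1.1) * (w.2 - e.1.2) - (e.2.2 - e.1.2) * (w.1 - e.1.1) = 0 := by
    unfold crossProd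
    simp only [Prod.fst_sub, Prod.snd_sub]
    exact_mod_cast Iff.rfl
  rw [this]
  unfold edgeHeight edgeSlope
  field_simp
  constructor <;> intro h <;> linarith

lemma ptsOn_eq_filter {e : Pt × Pt} (h : e.1.1 ≠ e.2.1) (S : Finset Pt) :
    ptsOn S e.1 (e.2 - e.1) = S.filter fun w => edgeHeight e w.1 = w.2 := by
  unfold ptsOn
  exact Finset.filter_congr fun w _ => (edgeHeight_eq_iff h w).symm

/-- The pairs of consecutive points on the lines spanned by the non-vertical pairs of
`richPairs S k`. -/
def richEdges (S : Finset Pt) (k : ℕ) : Finset (Pt × Pt) :=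
  (richPairs S k).filter fun e => e.1.1 < e.2.1 ∧
    ∀ w ∈ S, e.1.1 < w.1 → w.1 < e.2.1 → edgeHeight e w.1 ≠ w.2

/-- The lines spanned by the non-vertical pairs of `richPairs S k`. -/
def richLines (S : Finset Pt) (k : ℕ) : Finset (ℚ × ℚ) :=
  ((richPairs S k).filter fun e => e.1.1 ≠ e.2.1).image lineOf

lemma mem_richPairs {S : Finset Pt} {k : ℕ} {e : Pt × Pt} :
    e ∈ richPairs S k ↔ (e.1 ∈ S ∧ e.2 ∈ S) ∧ e.1 ≠ e.2 ∧
      k ≤ (ptsOn S e.1 (e.2 - e.1)).card ∧ (ptsOn S e.1 (e.2 - e.1)).card < 2 * k := by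
  simp [richPairs]

lemma lineOf_mem_richLines {S : Finset Pt} {k : ℕ} {e : Pt × Pt} (he : e ∈ richEdges S k) :
    lineOf e ∈ richLines S k := by
  simp only [richEdges, Finset.mem_filter] at he
  refine Finset.mem_image_of_mem _ ?_
  simp only [Finset.mem_filter]
  exact ⟨he.1, he.2.1.ne⟩

lemma card_nonvertical_richPairs_le (S : Finset Pt) (k : ℕ) :
    ((richPairs S k).filter fun e => e.1.1 ≠ e.2.1).card ≤
      (2 * k) ^ 2 * (richLines S k).card := by
  refine Finset.card_le_mul_card_image _ _ fun L hL => ?_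
  obtain ⟨e, he, rfl⟩ := Finset.mem_image.1 hL
  simp only [Finset.mem_filter, mem_richPairs] at he
  obtain ⟨⟨_, _, _, hlt⟩, hv⟩ := he
  calc _ ≤ ((ptsOn S e.1 (e.2 - e.1)) ×ˢ (ptsOn S e.1 (e.2 - e.1))).card := by
        refine Finset.card_le_card fun g hg => ?_
        simp only [Finset.mem_filter, mem_richPairs] at hg
        have h1 := edgeHeight_eq_of_lineOf_eq hg.2
        simp only [ptsOn_eq_filter hv, Finset.mem_product, Finset.mem_filter, ← h1]
        exact ⟨⟨hg.1.1.1.1, edgeHeight_left g⟩, ⟨hg.1.1.1.2, edgeHeight_right' hg.1.2⟩⟩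
    _ ≤ _ := by
        rw [Finset.card_product, sq]
        exact Nat.mul_le_mul hlt.le hlt.le

lemma mul_card_richLines_le (S : Finset Pt) (k : ℕ) :
    (k - 1) * (richLines S k).card ≤ (richEdges S k).card := by
  classical
  refine Finset.mul_card_image_le_card_of_maps_to
    (f := lineOf) (fun e he => lineOf_mem_richLines he) _ fun L hL => ?_
  obtain ⟨e, he, rfl⟩ := Finset.mem_image.1 hL
  simp only [Finset.mem_filter, mem_richPairs] at he
  obtain ⟨⟨_, hne, hk, hlt⟩, hv⟩ := he
  rw [ptsOn_eq_filter hv] at hk hlt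
  set T := S.filter fun w => edgeHeight e w.1 = w.2 with hT
  have hTmem : ∀ w, w ∈ T ↔ w ∈ S ∧ edgeHeight e w.1 = w.2 := fun w => by
    rw [hT, Finset.mem_filter]
  have hinj : ∀ p ∈ T, ∀ q ∈ T, p.1 = q.1 → p = q := by
    intro p hp q hq h
    refine Prod.ext h ?_
    have h1 := ((hTmem p).1 hp).2
    have h2 := ((hTmem q).1 hq).2
    rw [h, h2] at h1
    exact_mod_cast h1.symm
  rcases T.eq_empty_or_nonempty with h0 | h0
  · rw [h0, Finset.card_empty] at hk
    have : k = 0 := by omega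
    simp [this]
  obtain ⟨M, hM, hMmax⟩ := Finset.exists_max_image T (fun w => w.1) h0
  have hsucc : ∀ p, ∃ q, p ∈ T.erase M →
      q ∈ T ∧ p.1 < q.1 ∧ ∀ w ∈ T, p.1 < w.1 → q.1 ≤ w.1 := by
    intro p
    by_cases hp : p ∈ T.erase M
    · rw [Finset.mem_erase] at hp
      have hlt : p.1 < M.1 :=
        lt_of_le_of_ne (hMmax p hp.2) fun h => hp.1 (hinj p hp.2 M hM h)
      obtain ⟨q, hq, hqmin⟩ := Finset.exists_min_image (T.filter fun w => p.1 < w.1)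
        (fun w => w.1) ⟨M, by simp [hM, hlt]⟩
      simp only [Finset.mem_filter] at hq hqmin
      exact ⟨q, fun _ => ⟨hq.1, hq.2, fun w hw h => hqmin w ⟨hw, h⟩⟩⟩
    · exact ⟨p, fun h => absurd h hp⟩
  choose σ hσ using hsucc
  have hcard : k - 1 ≤ (T.erase M).card := by
    rw [Finset.card_erase_of_mem hM]; omega
  refine hcard.trans (Finset.card_le_card_of_injOn (fun p => (p, σ p)) ?_ ?_)
  · intro p hp
    obtain ⟨h1, h2, h3⟩ := hσ p hp
    have hpT : p ∈ T := Finset.mem_of_mem_erase hp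
    have hp2 := (hTmem _).1 hpT
    have hq2 := (hTmem _).1 h1
    have hl := lineOf_pair_eq h2.ne hp2.2 hq2.2
    have hh := edgeHeight_eq_of_lineOf_eq hl
    have hv' : ((p, σ p) : Pt × Pt).1.1 ≠ ((p, σ p) : Pt × Pt).2.1 := h2.ne
    have hpts : ptsOn S p (σ p - p) = T := by
      rw [hT, ← hh]
      exact ptsOn_eq_filter hv' S
    simp only [Finset.coe_filter, Set.mem_ofPred_eq, richEdges, Finset.mem_filter, mem_richPairs,
      hpts, hl, hh, and_true]
    refine ⟨⟨⟨hp2.1, hq2.1⟩, fun h => ?_, hk, hlt⟩, h2, fun w hw hw1 hw2 hw3 => ?_⟩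
    · rw [← h] at h2; exact lt_irrefl _ h2
    · have := h3 w ((hTmem _).2 ⟨hw, hw3⟩) hw1
      omega
  · intro p _ q _ h
    exact (Prod.mk.inj h).1

lemma mem_richEdges {S : Finset Pt} {k : ℕ} {e : Pt × Pt} (he : e ∈ richEdges S k) :
    e.1 ∈ S ∧ e.2 ∈ S ∧ e.1.1 < e.2.1 := by
  simp only [richEdges, Finset.mem_filter, mem_richPairs] at he
  exact ⟨he.1.1.1, he.1.1.2, he.2.1⟩

lemma richEdges_interior {S : Finset Pt} {k : ℕ} {e : Pt × Pt} (he : e ∈ richEdges S k) :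
    ∀ w ∈ S, e.1.1 < w.1 → w.1 < e.2.1 → edgeHeight e w.1 ≠ w.2 := by
  simp only [richEdges, Finset.mem_filter] at he
  exact he.2.2

/-- Distinct edges on the same line have disjoint interiors. -/
lemma richEdges_eq_of_lineOf_eq {S : Finset Pt} {k : ℕ} {e g : Pt × Pt} (he : e ∈ richEdges S k)
    (hg : g ∈ richEdges S k) (hl : lineOf e = lineOf g) {x : ℚ} (h1 : (e.1.1 : ℚ) < x)
    (h2 : x < e.2.1) (h3 : (g.1.1 : ℚ) < x) (h4 : x < g.2.1) : e = g := by
  have hh := edgeHeight_eq_of_lineOf_eq hl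
  obtain ⟨he1, he2, helt⟩ := mem_richEdges he
  obtain ⟨hg1, hg2, hglt⟩ := mem_richEdges hg
  have hi := richEdges_interior he
  have hj := richEdges_interior hg
  have a1 : e.1.1 < g.2.1 := by exact_mod_cast h1.trans h4
  have a2 : g.1.1 < e.2.1 := by exact_mod_cast h3.trans h2
  have gl := edgeHeight_left g
  have gr := edgeHeight_right hglt
  have el := edgeHeight_left e
  have er := edgeHeight_right helt
  have b1 : e.1.1 = g.1.1 := by
    refine le_antisymm ?_ ?_
    · by_contra hcon
      push Not at hcon
      exact hj e.1 he1 hcon a1 (hh ▸ el)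
    · by_contra hcon
      push Not at hcon
      exact hi g.1 hg1 hcon a2 (hh ▸ gl)
  have b2 : e.2.1 = g.2.1 := by
    refine le_antisymm ?_ ?_
    · by_contra hcon
      push Not at hcon
      exact hi g.2 hg2 a1 hcon (hh ▸ gr)
    · by_contra hcon
      push Not at hcon
      exact hj e.2 he2 a2 hcon (hh ▸ er)
  have c1 : (e.1.2 : ℚ) = g.1.2 := by rw [← el, ← gl, hh, b1]
  have c2 : (e.2.2 : ℚ) = g.2.2 := by rw [← er, ← gr, hh, b2]
  exact Prod.ext (Prod.ext b1 (by exact_mod_cast c1)) (Prod.ext b2 (by exact_mod_cast c2))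

lemma lineOf_ne_of_mem_crossingPairs {S : Finset Pt} {k : ℕ} {x : (Pt × Pt) × (Pt × Pt)}
    (hx : x ∈ crossingPairs (richEdges S k)) : lineOf x.1 ≠ lineOf x.2 := by
  simp only [crossingPairs, Finset.mem_filter, Finset.mem_product] at hx
  obtain ⟨⟨h1, h2⟩, hne, z, hz1, hz2, hz3, hz4, -⟩ := hx
  exact fun h => hne (richEdges_eq_of_lineOf_eq h1 h2 h hz1 hz3 hz2 hz4)

lemma card_crossingPairs_richEdges_le (S : Finset Pt) (k : ℕ) :
    (crossingPairs (richEdges S k)).card ≤ (richLines S k).card ^ 2 := by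
  rw [sq, ← Finset.card_product]
  refine Finset.card_le_card_of_injOn (fun x => (lineOf x.1, lineOf x.2)) ?_ ?_
  · intro x hx
    simp only [crossingPairs, Finset.coe_filter, Finset.mem_product, Set.mem_ofPred_eq] at hx
    simp only [Finset.coe_product, Set.mem_prod, Finset.mem_coe]
    exact ⟨lineOf_mem_richLines hx.1.1, lineOf_mem_richLines hx.1.2⟩
  · intro x hx y hy hxy
    simp only [Prod.mk.injEq] at hxy
    have hl := lineOf_ne_of_mem_crossingPairs hx
    simp only [crossingPairs, Finset.coe_filter, Finset.mem_product, Set.mem_ofPred_eq] at hx hy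
    obtain ⟨⟨h1, h2⟩, hne, z, hz1, hz2, hz3, hz4, hz⟩ := hx
    obtain ⟨⟨h1', h2'⟩, hne', z', hz1', hz2', hz3', hz4', hz'⟩ := hy
    have hzz : z = z' := by
      by_contra hcon
      refine hl (lineOf_eq_of_edgeHeight_eq hcon hz ?_)
      rw [edgeHeight_eq_of_lineOf_eq hxy.1, edgeHeight_eq_of_lineOf_eq hxy.2, hz']
    subst hzz
    exact Prod.ext (richEdges_eq_of_lineOf_eq h1 h1' hxy.1 hz1 hz3 hz1' hz3')
      (richEdges_eq_of_lineOf_eq h2 h2' hxy.2 hz2 hz4 hz2' hz4')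

lemma card_ends_of_mem_crossingPairs {S : Finset Pt} {k : ℕ} {x : (Pt × Pt) × (Pt × Pt)}
    (hx : x ∈ crossingPairs (richEdges S k)) :
    ({x.1.1, x.1.2, x.2.1, x.2.2} : Finset Pt).card = 4 := by
  have hl := lineOf_ne_of_mem_crossingPairs hx
  simp only [crossingPairs, Finset.mem_filter, Finset.mem_product] at hx
  obtain ⟨⟨h1, h2⟩, hne, z, hz1, hz2, hz3, hz4, hz⟩ := hx
  obtain ⟨-, -, helt⟩ := mem_richEdges h1
  obtain ⟨-, -, hglt⟩ := mem_richEdges h2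
  have el := edgeHeight_left x.1
  have er := edgeHeight_right helt
  have gl := edgeHeight_left x.2
  have gr := edgeHeight_right hglt
  have n1 : x.1.1 ≠ x.1.2 := fun h => by rw [h] at helt; exact lt_irrefl _ helt
  have n2 : x.2.1 ≠ x.2.2 := fun h => by rw [h] at hglt; exact lt_irrefl _ hglt
  have n3 : x.1.1 ≠ x.2.1 := fun h => by
    rw [← h] at gl
    exact hl (lineOf_eq_of_edgeHeight_eq hz1.ne' hz (el.trans gl.symm))
  have n4 : x.1.1 ≠ x.2.2 := fun h => by
    rw [← h] at gr
    exact hl (lineOf_eq_of_edgeHeight_eq hz1.ne' hz (el.trans gr.symm))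
  have n5 : x.1.2 ≠ x.2.1 := fun h => by
    rw [← h] at gl
    exact hl (lineOf_eq_of_edgeHeight_eq hz3.ne hz (er.trans gl.symm))
  have n6 : x.1.2 ≠ x.2.2 := fun h => by
    rw [← h] at gr
    exact hl (lineOf_eq_of_edgeHeight_eq hz3.ne hz (er.trans gr.symm))
  rw [Finset.card_insert_of_notMem (by simp [n1, n3, n4]),
    Finset.card_insert_of_notMem (by simp [n5, n6]), Finset.card_pair n2]

lemma card_vertical_richPairs_le (S : Finset Pt) (k : ℕ) :
    ((richPairs S k).filter fun e => ¬ e.1.1 ≠ e.2.1).card ≤ 2 * k * S.card := by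
  classical
  refine (Finset.card_le_mul_card_image (f := fun e => e.1) _ (2 * k) fun ξ hξ => ?_).trans
    (Nat.mul_le_mul_left _ (Finset.card_le_card ?_))
  · obtain ⟨e, he, rfl⟩ := Finset.mem_image.1 hξ
    simp only [Finset.mem_filter, mem_richPairs, not_not] at he
    obtain ⟨⟨_, hne, hk, hlt⟩, hv⟩ := he
    refine le_trans (Finset.card_le_card_of_injOn (fun g => g.2) ?_ ?_) hlt.le
    · intro g hg
      simp only [Finset.coe_filter, Finset.mem_filter, mem_richPairs, not_not,
        Set.mem_ofPred_eq] at hg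
      rw [Finset.mem_coe, mem_ptsOn]
      refine ⟨hg.1.1.1.2, ?_⟩
      simp only [crossProd, Prod.fst_sub, Prod.snd_sub]
      rw [← hv, ← hg.1.2, hg.2]
      ring
    · intro g hg g' hg' h
      simp only [Finset.coe_filter, Set.mem_ofPred_eq] at hg hg'
      exact Prod.ext (hg.2.trans hg'.2.symm) h
  · intro ξ hξ
    obtain ⟨e, he, rfl⟩ := Finset.mem_image.1 hξ
    simp only [Finset.mem_filter, mem_richPairs] at he
    exact he.1.1.1

/-- A form of the Szemerédi–Trotter theorem. -/
theorem card_richPairs_mul_le (S : Finset Pt) {k : ℕ} (hk : 2 ≤ k) :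
    (richPairs S k).card * k ≤ 2304 * S.card ^ 2 + 50 * S.card * k ^ 2 := by
  have h1 := card_nonvertical_richPairs_le S k
  have h2 := card_vertical_richPairs_le S k
  have h3 := Finset.card_filter_add_card_filter_not (s := richPairs S k)
    (fun e => e.1.1 ≠ e.2.1)
  have h4 := mul_card_richLines_le S k
  have h5 := card_crossingPairs_richEdges_le S k
  have h6 := crossing_lemma (S := S) (E := richEdges S k) (fun e he => mem_richEdges he)
    (fun e he => richEdges_interior he) (fun x hx => card_ends_of_mem_crossingPairs hx)
  have h7 : k * (richLines S k).card ≤ 2 * (richEdges S k).card := by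
    have : k ≤ 2 * (k - 1) := by omega
    calc _ ≤ 2 * (k - 1) * (richLines S k).card := Nat.mul_le_mul_right _ this
      _ ≤ _ := by rw [mul_assoc]; exact Nat.mul_le_mul_left _ h4
  set l := (richLines S k).card
  set e := (richEdges S k).card
  set N := S.card
  have h8 : 4 * k ^ 3 * l ≤ 2304 * N ^ 2 + 48 * N * k ^ 2 := by
    rcases h6 with h6 | h6
    · have : k * l ≤ 12 * N := by omega
      calc 4 * k ^ 3 * l = 4 * k ^ 2 * (k * l) := by ring
        _ ≤ 4 * k ^ 2 * (12 * N) := Nat.mul_le_mul_left _ this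
        _ = 48 * N * k ^ 2 := by ring
        _ ≤ _ := Nat.le_add_left _ _
    · have h9 : k ^ 3 * l * l ^ 2 ≤ 576 * N ^ 2 * l ^ 2 := by
        calc k ^ 3 * l * l ^ 2 = (k * l) ^ 3 := by ring
          _ ≤ (2 * e) ^ 3 := Nat.pow_le_pow_left h7 3
          _ = 8 * e ^ 3 := by ring
          _ ≤ 8 * (72 * N ^ 2 * l ^ 2) :=
            Nat.mul_le_mul_left _ (h6.trans (Nat.mul_le_mul_left _ h5))
          _ = _ := by ring
      rcases Nat.eq_zero_or_pos l with hl | hl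
      · simp [hl]
      · have := Nat.le_of_mul_le_mul_right h9 (by positivity)
        nlinarith
  calc (richPairs S k).card * k ≤ ((2 * k) ^ 2 * l + 2 * k * N) * k :=
        Nat.mul_le_mul_right _ (by omega)
    _ = 4 * k ^ 3 * l + 2 * N * k ^ 2 := by ring
    _ ≤ _ := by linarith

/-- The dot product of two lattice vectors. -/
def dotProd (d v : Pt) : ℤ := d.1 * v.1 + d.2 * v.2

/-- Rotation by a right angle. -/
def perp (d : Pt) : Pt := (-d.2, d.1)

/-- The larger of the two numbers of points of `S` on the lines through `ξ` parallel and
perpendicular to `d`. -/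
def crossCount (S : Finset Pt) (ξ d : Pt) : ℕ :=
  max (ptsOn S ξ d).card (ptsOn S ξ (perp d)).card

lemma perp_ne_zero {d : Pt} (hd : d ≠ 0) : perp d ≠ 0 := by
  contrapose! hd
  simp only [perp, Prod.mk_eq_zero, neg_eq_zero] at hd
  exact Prod.ext hd.2 hd.1

lemma crossProd_eq_zero_of_parallel {d e v : Pt} (hd : d ≠ 0) (h : crossProd d e = 0)
    (hv : crossProd d v = 0) : crossProd e v = 0 := by
  simp only [crossProd] at *
  by_cases h1 : d.1 = 0
  · have h2 : d.2 ≠ 0 := fun h2 => hd (Prod.ext h1 h2)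
    refine (mul_eq_zero.1 (?_ : d.2 * _ = 0)).resolve_left h2
    linear_combination e.2 * hv - v.2 * h
  · refine (mul_eq_zero.1 (?_ : d.1 * _ = 0)).resolve_left h1
    linear_combination e.1 * hv - v.1 * h

lemma crossProd_comm_eq_zero {d e : Pt} (h : crossProd d e = 0) : crossProd e d = 0 := by
  simp only [crossProd] at *
  linarith

lemma dotProd_comm (d e : Pt) : dotProd d e = dotProd e d := by
  simp only [dotProd]; ring

lemma crossProd_perp (d e : Pt) : crossProd (perp d) e = -dotProd d e := by
  simp only [crossProd, perp, dotProd]; ring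

lemma crossProd_perp_eq_zero {d e : Pt} : crossProd (perp d) e = 0 ↔ dotProd d e = 0 := by
  rw [crossProd_perp, neg_eq_zero]

lemma crossProd_perp_perp (d e : Pt) : crossProd (perp d) (perp e) = crossProd d e := by
  simp only [crossProd, perp]; ring

lemma crossProd_self (d : Pt) : crossProd d d = 0 := by simp only [crossProd]; ring

lemma ptsOn_congr (S : Finset Pt) (ξ : Pt) {d e : Pt} (hd : d ≠ 0) (he : e ≠ 0)
    (h : crossProd d e = 0) : ptsOn S ξ d = ptsOn S ξ e := by
  ext p
  rw [mem_ptsOn, mem_ptsOn]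
  exact and_congr_right fun _ => ⟨crossProd_eq_zero_of_parallel hd h,
    crossProd_eq_zero_of_parallel he (crossProd_comm_eq_zero h)⟩

lemma ptsOn_eq_of_mem (S : Finset Pt) {ξ η d : Pt} (h : crossProd d (η - ξ) = 0) :
    ptsOn S η d = ptsOn S ξ d := by
  ext p
  rw [mem_ptsOn, mem_ptsOn]
  refine and_congr_right fun _ => ?_
  simp only [crossProd, Prod.fst_sub, Prod.snd_sub] at *
  constructor <;> intro h' <;> linarith

lemma crossCount_of_parallel (S : Finset Pt) (ξ : Pt) {d e : Pt} (hd : d ≠ 0) (he : e ≠ 0)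
    (h : crossProd d e = 0) : crossCount S ξ d = crossCount S ξ e := by
  rw [crossCount, crossCount, ptsOn_congr S ξ hd he h,
    ptsOn_congr S ξ (perp_ne_zero hd) (perp_ne_zero he) (by rwa [crossProd_perp_perp])]

lemma crossCount_perp (S : Finset Pt) (ξ d : Pt) :
    crossCount S ξ (perp d) = crossCount S ξ d := by
  have : ptsOn S ξ (perp (perp d)) = ptsOn S ξ d := by
    ext p
    rw [mem_ptsOn, mem_ptsOn]
    refine and_congr_right fun _ => ?_
    simp only [crossProd, perp]
    constructor <;> intro h' <;> linarith
  rw [crossCount, crossCount, this, max_comm]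

lemma crossCount_of_perpendicular (S : Finset Pt) (ξ : Pt) {d e : Pt} (hd : d ≠ 0) (he : e ≠ 0)
    (h : dotProd d e = 0) : crossCount S ξ d = crossCount S ξ e := by
  rw [← crossCount_perp S ξ d]
  exact crossCount_of_parallel S ξ (perp_ne_zero hd) he (crossProd_perp_eq_zero.2 h)

lemma self_mem_ptsOn {S : Finset Pt} {ξ : Pt} (h : ξ ∈ S) (d : Pt) : ξ ∈ ptsOn S ξ d := by
  rw [mem_ptsOn]
  exact ⟨h, by simp [crossProd]⟩

lemma crossCount_pos {S : Finset Pt} {ξ : Pt} (h : ξ ∈ S) (d : Pt) : 0 < crossCount S ξ d :=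
  lt_of_lt_of_le (Finset.card_pos.2 ⟨ξ, self_mem_ptsOn h d⟩) (le_max_left _ _)

/-- Nondegenerate rectangles, with vertices in cyclic order. -/
def IsProperRect (q : Pt × Pt × Pt × Pt) : Prop :=
  q.1 + q.2.2.1 = q.2.1 + q.2.2.2 ∧ dotProd (q.2.1 - q.1) (q.2.2.2 - q.1) = 0 ∧
    q.2.1 ≠ q.1 ∧ q.2.2.2 ≠ q.1

open Classical in
/-- The nondegenerate rectangles with vertices in given sets and with given dyadic sizes of
the numbers of points on the crosses spanned by the sides. -/
def rects (S₁ S₂ S₃ S₄ : Finset Pt) (a₁ a₂ a₃ a₄ : ℕ) : Finset (Pt × Pt × Pt × Pt) :=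
  (S₁ ×ˢ S₂ ×ˢ S₃ ×ˢ S₄).filter fun q => IsProperRect q ∧
    Nat.log 2 (crossCount S₁ q.1 (q.2.1 - q.1)) = a₁ ∧
    Nat.log 2 (crossCount S₂ q.2.1 (q.2.1 - q.1)) = a₂ ∧
    Nat.log 2 (crossCount S₃ q.2.2.1 (q.2.1 - q.1)) = a₃ ∧
    Nat.log 2 (crossCount S₄ q.2.2.2 (q.2.1 - q.1)) = a₄

lemma mem_rects {S₁ S₂ S₃ S₄ : Finset Pt} {a₁ a₂ a₃ a₄ : ℕ} {p₁ p₂ p₃ p₄ : Pt} :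
    (p₁, p₂, p₃, p₄) ∈ rects S₁ S₂ S₃ S₄ a₁ a₂ a₃ a₄ ↔
      (p₁ ∈ S₁ ∧ p₂ ∈ S₂ ∧ p₃ ∈ S₃ ∧ p₄ ∈ S₄) ∧ (p₁ + p₃ = p₂ + p₄ ∧
      dotProd (p₂ - p₁) (p₄ - p₁) = 0 ∧ p₂ ≠ p₁ ∧ p₄ ≠ p₁) ∧
      Nat.log 2 (crossCount S₁ p₁ (p₂ - p₁)) = a₁ ∧
      Nat.log 2 (crossCount S₂ p₂ (p₂ - p₁)) = a₂ ∧
      Nat.log 2 (crossCount S₃ p₃ (p₂ - p₁)) = a₃ ∧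
      Nat.log 2 (crossCount S₄ p₄ (p₂ - p₁)) = a₄ := by
  classical
  rw [rects, Finset.mem_filter]
  simp only [Finset.mem_product, IsProperRect]

lemma card_rects_reflect (S₁ S₂ S₃ S₄ : Finset Pt) (a₁ a₂ a₃ a₄ : ℕ) :
    (rects S₁ S₂ S₃ S₄ a₁ a₂ a₃ a₄).card ≤ (rects S₁ S₄ S₃ S₂ a₁ a₄ a₃ a₂).card := by
  refine Finset.card_le_card_of_injOn (fun q => (q.1, q.2.2.2, q.2.2.1, q.2.1)) ?_ ?_
  · rintro ⟨p₁, p₂, p₃, p₄⟩ h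
    rw [Finset.mem_coe, mem_rects] at h
    rw [Finset.mem_coe, mem_rects]
    obtain ⟨⟨h1, h2, h3, h4⟩, ⟨hp, hd, h21, h41⟩, g1, g2, g3, g4⟩ := h
    have hc (S : Finset Pt) (ξ : Pt) : crossCount S ξ (p₄ - p₁) = crossCount S ξ (p₂ - p₁) :=
      crossCount_of_perpendicular S ξ (sub_ne_zero.2 h41) (sub_ne_zero.2 h21)
        (by rwa [dotProd_comm])
    simp only [hc]
    exact ⟨⟨h1, h4, h3, h2⟩, ⟨by rw [hp, add_comm], by rwa [dotProd_comm], h41, h21⟩,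
      g1, g4, g3, g2⟩
  · rintro ⟨p₁, p₂, p₃, p₄⟩ _ ⟨p₁', p₂', p₃', p₄'⟩ _ h
    simp only [Prod.mk.injEq] at h ⊢
    tauto

lemma card_rects_rotate (S₁ S₂ S₃ S₄ : Finset Pt) (a₁ a₂ a₃ a₄ : ℕ) :
    (rects S₁ S₂ S₃ S₄ a₁ a₂ a₃ a₄).card ≤ (rects S₂ S₃ S₄ S₁ a₂ a₃ a₄ a₁).card := by
  refine Finset.card_le_card_of_injOn (fun q => (q.2.1, q.2.2.1, q.2.2.2, q.1)) ?_ ?_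
  · rintro ⟨p₁, p₂, p₃, p₄⟩ h
    rw [Finset.mem_coe, mem_rects] at h
    rw [Finset.mem_coe, mem_rects]
    obtain ⟨⟨h1, h2, h3, h4⟩, ⟨hp, hd, h21, h41⟩, g1, g2, g3, g4⟩ := h
    have h32 : p₃ - p₂ = p₄ - p₁ := by
      rw [sub_eq_sub_iff_add_eq_add, add_comm, hp, add_comm]
    have hc (S : Finset Pt) (ξ : Pt) : crossCount S ξ (p₄ - p₁) = crossCount S ξ (p₂ - p₁) :=
      crossCount_of_perpendicular S ξ (sub_ne_zero.2 h41) (sub_ne_zero.2 h21)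
        (by rwa [dotProd_comm])
    have h32' : p₃ ≠ p₂ := by
      rw [← sub_ne_zero, h32, sub_ne_zero]
      exact h41
    simp only [h32, hc]
    refine ⟨⟨h2, h3, h4, h1⟩, ⟨by rw [add_comm p₃, hp], ?_, h32', h21.symm⟩, g2, g3, g4, g1⟩
    simp only [dotProd, Prod.fst_sub, Prod.snd_sub] at hd ⊢
    linarith
  · rintro ⟨p₁, p₂, p₃, p₄⟩ _ ⟨p₁', p₂', p₃', p₄'⟩ _ h
    simp only [Prod.mk.injEq] at h ⊢
    tauto

lemma card_le_mul_of_maps {α β γ : Type*} (A : Finset α) (f : α → β) (g : α → γ)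
    (B : Finset β) (D : β → Finset γ) {M N : ℕ} (hf : ∀ x ∈ A, f x ∈ B)
    (hg : ∀ x ∈ A, g x ∈ D (f x)) (hB : B.card ≤ M) (hD : ∀ y ∈ B, (D y).card ≤ N)
    (hinj : ∀ x ∈ A, ∀ y ∈ A, f x = f y → g x = g y → x = y) : A.card ≤ M * N := by
  classical
  calc A.card ≤ (B.sigma D).card := by
        refine Finset.card_le_card_of_injOn (fun x => ⟨f x, g x⟩) ?_ ?_
        · intro x hx
          rw [Finset.mem_coe, Finset.mem_sigma]
          exact ⟨hf x hx, hg x hx⟩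
        · intro x hx y hy h
          rw [Sigma.mk.injEq] at h
          exact hinj x hx y hy h.1 (eq_of_heq h.2)
    _ = ∑ y ∈ B, (D y).card := Finset.card_sigma _ _
    _ ≤ B.card * N := by
        rw [← smul_eq_mul]
        exact Finset.sum_le_card_nsmul _ _ _ hD
    _ ≤ M * N := Nat.mul_le_mul_right _ hB

/-- The points `p` of `S` on a line with `crossCount S p d` of dyadic size `a`. -/
def sparsePts (S : Finset Pt) (ξ g d : Pt) (a : ℕ) : Finset Pt :=
  (ptsOn S ξ g).filter fun p => Nat.log 2 (crossCount S p d) = a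

lemma card_sparsePts_le (S : Finset Pt) (ξ : Pt) {g d : Pt} (hg : g ≠ 0) (hd : d ≠ 0) (a : ℕ)
    (h : crossProd d g = 0 ∨ dotProd d g = 0) : (sparsePts S ξ g d a).card ≤ 2 ^ (a + 1) := by
  rcases (sparsePts S ξ g d a).eq_empty_or_nonempty with h0 | ⟨p, hp⟩
  · simp [h0]
  · have hp' := hp
    rw [sparsePts, Finset.mem_filter, mem_ptsOn] at hp'
    have h1 : Nat.log 2 (crossCount S p g) = a := by
      rw [← hp'.2]
      rcases h with h | h
      · rw [crossCount_of_parallel S p hd hg h]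
      · rw [crossCount_of_perpendicular S p hd hg h]
    have h2 := Nat.lt_pow_succ_log_self (b := 2) (by norm_num) (crossCount S p g)
    rw [h1] at h2
    refine le_trans ((Finset.card_filter_le _ _).trans ?_) h2.le
    rw [← ptsOn_eq_of_mem S hp'.1.2]
    exact le_max_left _ _

lemma mem_sparsePts {S : Finset Pt} {ξ g d p : Pt} {a : ℕ} : p ∈ sparsePts S ξ g d a ↔
    p ∈ S ∧ crossProd g (p - ξ) = 0 ∧ Nat.log 2 (crossCount S p d) = a := by
  rw [sparsePts, Finset.mem_filter, mem_ptsOn, and_assoc]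

section

variable {S₁ S₂ S₃ S₄ : Finset Pt} {a₁ a₂ a₃ a₄ : ℕ}

lemma eq_of_mem_rects {q r : Pt × Pt × Pt × Pt} (hq : q ∈ rects S₁ S₂ S₃ S₄ a₁ a₂ a₃ a₄)
    (hr : r ∈ rects S₁ S₂ S₃ S₄ a₁ a₂ a₃ a₄) (h1 : q.1 = r.1) (h2 : q.2.1 = r.2.1)
    (h : q.2.2.1 = r.2.2.1 ∨ q.2.2.2 = r.2.2.2) : q = r := by
  obtain ⟨p₁, p₂, p₃, p₄⟩ := q
  obtain ⟨r₁, r₂, r₃, r₄⟩ := r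
  have e1 := (mem_rects.1 hq).2.1.1
  have e2 := (mem_rects.1 hr).2.1.1
  simp only at h1 h2 h
  subst h1 h2
  rcases h with rfl | rfl
  · rw [e1] at e2
    rw [add_left_cancel e2]
  · rw [← e2] at e1
    rw [add_left_cancel e1]

lemma card_rects_le_of_side (S₁ S₂ S₃ S₄ : Finset Pt) (a₁ a₂ a₃ a₄ : ℕ) :
    (rects S₁ S₂ S₃ S₄ a₁ a₂ a₃ a₄).card ≤ S₁.card * S₂.card * 2 ^ (a₃ + 1) := by
  classical
  refine card_le_mul_of_maps _ (fun q => (q.1, q.2.1)) (fun q => q.2.2.1)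
    ((S₁ ×ˢ S₂).filter fun x => x.1 ≠ x.2)
    (fun x => sparsePts S₃ x.2 (perp (x.2 - x.1)) (x.2 - x.1) a₃) ?_ ?_ ?_ ?_ ?_
  · rintro ⟨p₁, p₂, p₃, p₄⟩ h
    rw [mem_rects] at h
    simp only [Finset.mem_filter, Finset.mem_product]
    exact ⟨⟨h.1.1, h.1.2.1⟩, h.2.1.2.2.1.symm⟩
  · rintro ⟨p₁, p₂, p₃, p₄⟩ h
    rw [mem_rects] at h
    have h32 : p₃ - p₂ = p₄ - p₁ := by
      rw [sub_eq_sub_iff_add_eq_add, add_comm, h.2.1.1, add_comm]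
    rw [mem_sparsePts]
    refine ⟨h.1.2.2.1, ?_, h.2.2.2.2.1⟩
    simp only [h32]
    exact crossProd_perp_eq_zero.2 h.2.1.2.1
  · exact (Finset.card_filter_le _ _).trans (Finset.card_product _ _).le
  · intro x hx
    have hx' : x.2 - x.1 ≠ 0 := sub_ne_zero.2 (Finset.mem_filter.1 hx).2.symm
    refine card_sparsePts_le _ _ (perp_ne_zero hx') hx' _ (Or.inr ?_)
    simp only [dotProd, perp]
    ring
  · intro q hq r hr h1 h2
    simp only [Prod.mk.injEq] at h1
    exact eq_of_mem_rects hq hr h1.1 h1.2 (Or.inl h2)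

/-- The members of `rects` with first vertex `p` and first side parallel to `g`. -/
def rectsAt (S₁ S₂ S₃ S₄ : Finset Pt) (a₁ a₂ a₃ a₄ : ℕ) (p g : Pt) :
    Finset (Pt × Pt × Pt × Pt) :=
  (rects S₁ S₂ S₃ S₄ a₁ a₂ a₃ a₄).filter fun q => q.1 = p ∧ crossProd g (q.2.1 - q.1) = 0

lemma card_rectsAt_le_of_neighbors {p g : Pt} (hg : g ≠ 0) :
    (rectsAt S₁ S₂ S₃ S₄ a₁ a₂ a₃ a₄ p g).card ≤ 2 ^ (a₂ + 1) * 2 ^ (a₄ + 1) := by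
  classical
  refine card_le_mul_of_maps _ (fun q => q.2.1) (fun q => q.2.2.2)
    (sparsePts S₂ p g g a₂) (fun x => sparsePts S₄ p (perp g) g a₄) ?_ ?_ ?_ ?_ ?_
  · rintro ⟨p₁, p₂, p₃, p₄⟩ h
    rw [rectsAt, Finset.mem_filter, mem_rects] at h
    obtain ⟨⟨⟨h1, h2, h3, h4⟩, ⟨hp, hd, h21, h41⟩, g1, g2, g3, g4⟩, rfl, hc⟩ := h
    rw [mem_sparsePts, crossCount_of_parallel _ _ hg (sub_ne_zero.2 h21) hc]
    exact ⟨h2, hc, g2⟩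
  · rintro ⟨p₁, p₂, p₃, p₄⟩ h
    rw [rectsAt, Finset.mem_filter, mem_rects] at h
    obtain ⟨⟨⟨h1, h2, h3, h4⟩, ⟨hp, hd, h21, h41⟩, g1, g2, g3, g4⟩, rfl, hc⟩ := h
    rw [mem_sparsePts, crossCount_of_parallel _ _ hg (sub_ne_zero.2 h21) hc]
    refine ⟨h4, ?_, g4⟩
    rw [← crossProd_perp_perp] at hc
    exact crossProd_eq_zero_of_parallel (perp_ne_zero (sub_ne_zero.2 h21))
      (crossProd_comm_eq_zero hc) (crossProd_perp_eq_zero.2 hd)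
  · exact card_sparsePts_le _ _ hg hg _ (Or.inl (crossProd_self g))
  · intro x _
    refine card_sparsePts_le _ _ (perp_ne_zero hg) hg _ (Or.inr ?_)
    simp only [dotProd, perp]
    ring
  · intro q hq r hr h1 h2
    rw [rectsAt, Finset.mem_filter] at hq hr
    exact eq_of_mem_rects hq.1 hr.1 (hq.2.1.trans hr.2.1.symm) h1 (Or.inr h2)

lemma card_rectsAt_le_of_path {p g : Pt} (hg : g ≠ 0) :
    (rectsAt S₁ S₂ S₃ S₄ a₁ a₂ a₃ a₄ p g).card ≤ 2 ^ (a₂ + 1) * 2 ^ (a₃ + 1) := by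
  classical
  refine card_le_mul_of_maps _ (fun q => q.2.1) (fun q => q.2.2.1)
    (sparsePts S₂ p g g a₂) (fun x => sparsePts S₃ x (perp g) g a₃) ?_ ?_ ?_ ?_ ?_
  · rintro ⟨p₁, p₂, p₃, p₄⟩ h
    rw [rectsAt, Finset.mem_filter, mem_rects] at h
    obtain ⟨⟨⟨h1, h2, h3, h4⟩, ⟨hp, hd, h21, h41⟩, g1, g2, g3, g4⟩, rfl, hc⟩ := h
    rw [mem_sparsePts, crossCount_of_parallel _ _ hg (sub_ne_zero.2 h21) hc]
    exact ⟨h2, hc, g2⟩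
  · rintro ⟨p₁, p₂, p₃, p₄⟩ h
    rw [rectsAt, Finset.mem_filter, mem_rects] at h
    obtain ⟨⟨⟨h1, h2, h3, h4⟩, ⟨hp, hd, h21, h41⟩, g1, g2, g3, g4⟩, rfl, hc⟩ := h
    have h32 : p₃ - p₂ = p₄ - p₁ := by
      rw [sub_eq_sub_iff_add_eq_add, add_comm, hp, add_comm]
    rw [mem_sparsePts, crossCount_of_parallel _ _ hg (sub_ne_zero.2 h21) hc]
    refine ⟨h3, ?_, g3⟩
    rw [← crossProd_perp_perp] at hc
    simp only [h32]
    exact crossProd_eq_zero_of_parallel (perp_ne_zero (sub_ne_zero.2 h21))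
      (crossProd_comm_eq_zero hc) (crossProd_perp_eq_zero.2 hd)
  · exact card_sparsePts_le _ _ hg hg _ (Or.inl (crossProd_self g))
  · intro x _
    refine card_sparsePts_le _ _ (perp_ne_zero hg) hg _ (Or.inr ?_)
    simp only [dotProd, perp]
    ring
  · intro q hq r hr h1 h2
    rw [rectsAt, Finset.mem_filter] at hq hr
    exact eq_of_mem_rects hq.1 hr.1 (hq.2.1.trans hr.2.1.symm) h1 (Or.inl h2)

lemma card_rects_mul_le (ha : 1 ≤ a₁) {F : ℕ}
    (hF : ∀ p g : Pt, g ≠ 0 → (rectsAt S₁ S₂ S₃ S₄ a₁ a₂ a₃ a₄ p g).card ≤ F) :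
    (rects S₁ S₂ S₃ S₄ a₁ a₂ a₃ a₄).card * 2 ^ (a₁ - 1) ≤
      (richPairs S₁ (2 ^ a₁)).card * (2 * F) := by
  classical
  refine Finset.card_mul_le_card_mul (fun (q : Pt × Pt × Pt × Pt) (e : Pt × Pt) => q.1 = e.1 ∧
    (crossProd (e.2 - e.1) (q.2.1 - q.1) = 0 ∨
      crossProd (perp (e.2 - e.1)) (q.2.1 - q.1) = 0)) ?_ ?_
  · rintro ⟨p₁, p₂, p₃, p₄⟩ h
    rw [mem_rects] at h
    obtain ⟨⟨h1, h2, h3, h4⟩, ⟨hp, hd, h21, h41⟩, g1, g2, g3, g4⟩ := h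
    have key : ∃ g : Pt, g ≠ 0 ∧ (ptsOn S₁ p₁ g).card = crossCount S₁ p₁ (p₂ - p₁) ∧
        (crossProd g (p₂ - p₁) = 0 ∨ crossProd (perp g) (p₂ - p₁) = 0) := by
      rcases max_choice (ptsOn S₁ p₁ (p₂ - p₁)).card (ptsOn S₁ p₁ (perp (p₂ - p₁))).card with h | h
      · exact ⟨p₂ - p₁, sub_ne_zero.2 h21, h.symm, Or.inl (crossProd_self _)⟩
      · refine ⟨perp (p₂ - p₁), perp_ne_zero (sub_ne_zero.2 h21), h.symm, Or.inr ?_⟩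
        simp only [crossProd, perp]
        ring
    obtain ⟨g, hg0, hg, hgd⟩ := key
    have hpos := crossCount_pos h1 (p₂ - p₁)
    have l1 := Nat.pow_log_le_self 2 hpos.ne'
    have l2 := Nat.lt_pow_succ_log_self (b := 2) (by norm_num) (crossCount S₁ p₁ (p₂ - p₁))
    rw [g1, ← hg] at l1 l2
    have hc : ((ptsOn S₁ p₁ g).erase p₁).card = (ptsOn S₁ p₁ g).card - 1 :=
      Finset.card_erase_of_mem (self_mem_ptsOn h1 g)
    have hpow : 2 ^ a₁ = 2 * 2 ^ (a₁ - 1) := by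
      rw [← pow_succ']
      congr 1
      omega
    have hpow' : 1 ≤ 2 ^ (a₁ - 1) := Nat.one_le_two_pow
    refine le_trans (by omega : 2 ^ (a₁ - 1) ≤ ((ptsOn S₁ p₁ g).erase p₁).card) ?_
    refine Finset.card_le_card_of_injOn (fun η => (p₁, η)) ?_
      (fun x _ y _ hxy => (Prod.mk.inj hxy).2)
    intro η hη
    rw [Finset.mem_coe, Finset.mem_erase, mem_ptsOn] at hη
    obtain ⟨hη1, hη2, hη3⟩ := hη
    have hη0 : η - p₁ ≠ 0 := sub_ne_zero.2 hη1
    rw [Finset.mem_coe, Finset.mem_bipartiteAbove, mem_richPairs]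
    rw [← ptsOn_congr S₁ p₁ hg0 hη0 hη3]
    refine ⟨⟨⟨h1, hη2⟩, hη1.symm, l1, by rw [pow_succ] at l2; omega⟩, rfl, ?_⟩
    refine hgd.imp (fun h => crossProd_eq_zero_of_parallel hg0 hη3 h)
      (fun h => crossProd_eq_zero_of_parallel (perp_ne_zero hg0) ?_ h)
    rwa [crossProd_perp_perp]
  · intro e he
    rw [mem_richPairs] at he
    have he0 : e.2 - e.1 ≠ 0 := sub_ne_zero.2 he.2.1.symm
    have h1 := hF e.1 (e.2 - e.1) he0
    have h2 := hF e.1 (perp (e.2 - e.1)) (perp_ne_zero he0)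
    refine le_trans (Finset.card_le_card (t := rectsAt S₁ S₂ S₃ S₄ a₁ a₂ a₃ a₄ e.1 (e.2 - e.1) ∪
      rectsAt S₁ S₂ S₃ S₄ a₁ a₂ a₃ a₄ e.1 (perp (e.2 - e.1))) ?_)
      ((Finset.card_union_le _ _).trans (by omega))
    intro q hq
    rw [Finset.mem_bipartiteBelow] at hq
    rw [Finset.mem_union, rectsAt, rectsAt, Finset.mem_filter, Finset.mem_filter]
    exact hq.2.2.imp (fun h => ⟨hq.1, hq.2.1, h⟩) (fun h => ⟨hq.1, hq.2.1, h⟩)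

lemma card_rects_mul_pow_le {C j F : ℕ} (ha : 1 ≤ a₁) (hS : S₁.card ≤ 2 ^ j)
    (haj : 2 * a₁ ≤ j + 2 * C)
    (hF : ∀ p g : Pt, g ≠ 0 → (rectsAt S₁ S₂ S₃ S₄ a₁ a₂ a₃ a₄ p g).card ≤ F) :
    (rects S₁ S₂ S₃ S₄ a₁ a₂ a₃ a₄).card * 2 ^ (2 * a₁) ≤
      4 * (2304 + 50 * 4 ^ C) * 2 ^ (2 * j) * F := by
  have h1 := card_rects_mul_le ha hF
  have h2 := card_richPairs_mul_le S₁ (k := 2 ^ a₁) (by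
    calc 2 = 2 ^ 1 := rfl
      _ ≤ 2 ^ a₁ := Nat.pow_le_pow_right (by norm_num) ha)
  have hpow : 2 ^ a₁ = 2 * 2 ^ (a₁ - 1) := by
    rw [← pow_succ']
    congr 1
    omega
  have h3 : (2 ^ a₁) ^ 2 ≤ 2 ^ j * 4 ^ C := by
    calc (2 ^ a₁) ^ 2 = 2 ^ (2 * a₁) := by rw [← pow_mul, mul_comm]
      _ ≤ 2 ^ (j + 2 * C) := Nat.pow_le_pow_right (by norm_num) haj
      _ = 2 ^ j * 4 ^ C := by rw [pow_add, pow_mul]; norm_num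
  have h4 : (richPairs S₁ (2 ^ a₁)).card * 2 ^ a₁ ≤ (2304 + 50 * 4 ^ C) * 2 ^ (2 * j) := by
    calc _ ≤ 2304 * S₁.card ^ 2 + 50 * S₁.card * (2 ^ a₁) ^ 2 := h2
      _ ≤ 2304 * (2 ^ j) ^ 2 + 50 * 2 ^ j * (2 ^ j * 4 ^ C) := by gcongr
      _ = _ := by rw [pow_mul']; ring
  calc (rects S₁ S₂ S₃ S₄ a₁ a₂ a₃ a₄).card * 2 ^ (2 * a₁)
      = 2 * ((rects S₁ S₂ S₃ S₄ a₁ a₂ a₃ a₄).card * 2 ^ (a₁ - 1)) * 2 ^ a₁ := by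
        rw [pow_mul', sq]
        nth_rewrite 1 [hpow]
        ring
    _ ≤ 2 * ((richPairs S₁ (2 ^ a₁)).card * (2 * F)) * 2 ^ a₁ := by gcongr
    _ = 4 * ((richPairs S₁ (2 ^ a₁)).card * 2 ^ a₁) * F := by ring
    _ ≤ 4 * ((2304 + 50 * 4 ^ C) * 2 ^ (2 * j)) * F := by gcongr
    _ = _ := by ring

end

lemma exponent_bound_of_rich {n j₁ j₂ j₃ j₄ a₁ a₂ a₃ a₄ : ℝ}
    (h1 : n ≤ 2 * j₁ - 2 * a₁ + a₂ + a₃) (h2 : n ≤ 2 * j₁ - 2 * a₁ + a₂ + a₄)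
    (h3 : n ≤ 2 * j₁ - 2 * a₁ + a₃ + a₄)
    (h4 : n ≤ 2 * j₂ - 2 * a₂ + a₁ + a₃) (h5 : n ≤ 2 * j₂ - 2 * a₂ + a₁ + a₄)
    (h6 : n ≤ 2 * j₂ - 2 * a₂ + a₃ + a₄)
    (h7 : n ≤ 2 * j₃ - 2 * a₃ + a₁ + a₂) (h8 : n ≤ 2 * j₃ - 2 * a₃ + a₁ + a₄)
    (h9 : n ≤ 2 * j₃ - 2 * a₃ + a₂ + a₄)
    (h10 : n ≤ 2 * j₄ - 2 * a₄ + a₁ + a₂) (h11 : n ≤ 2 * j₄ - 2 * a₄ + a₁ + a₃) :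
    n ≤ (j₁ + j₂ + j₃ + j₄) / 2 - (|j₁ - j₃| + |j₂ - j₄| +
      (|a₂ - a₁| + |a₃ - a₁| + |a₄ - a₁|)) / 32 := by
  rcases abs_choice (j₁ - j₃) with h | h <;> rcases abs_choice (j₂ - j₄) with h' | h' <;>
  rcases abs_choice (a₂ - a₁) with e | e <;> rcases abs_choice (a₃ - a₁) with e' | e' <;>
  rcases abs_choice (a₄ - a₁) with e'' | e'' <;> rw [h, h', e, e', e''] <;> linarith

lemma exponent_bound_of_mixed {n j₁ j₂ j₃ j₄ a₁ a₂ : ℝ} (ha₁ : 0 ≤ a₁) (ha₂ : 0 ≤ a₂)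
    (h1 : n ≤ 2 * j₁ - 2 * a₁) (h2 : n ≤ 2 * j₂ - 2 * a₂)
    (h3 : n ≤ j₃ + j₄ + a₁) (h4 : n ≤ j₃ + j₄ + a₂)
    (h5 : n ≤ j₂ + j₃) (h6 : n ≤ j₁ + j₄) :
    n ≤ (j₁ + j₂ + j₃ + j₄) / 2 - (|j₁ - j₃| + |j₂ - j₄| + (|a₁ - a₂| + 2 * (a₁ + a₂))) / 32 := by
  rcases abs_choice (j₁ - j₃) with h | h <;> rcases abs_choice (j₂ - j₄) with h' | h' <;>
  rcases abs_choice (a₁ - a₂) with e | e <;> rw [h, h', e] <;> linarith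

lemma exponent_bound_of_poor {n j₁ j₂ j₃ j₄ : ℝ}
    (h1 : n ≤ j₁ + j₂) (h2 : n ≤ j₂ + j₃) (h3 : n ≤ j₃ + j₄) (h4 : n ≤ j₄ + j₁) :
    n ≤ (j₁ + j₂ + j₃ + j₄) / 2 - (|j₁ - j₃| + |j₂ - j₄|) / 32 := by
  rcases abs_choice (j₁ - j₃) with h | h <;> rcases abs_choice (j₂ - j₄) with h' | h' <;>
  rw [h, h'] <;> linarith

/-- The constant in the counting bounds for rectangles. -/
def rectConst (C : ℕ) : ℕ := 16 * (2304 + 50 * 4 ^ C)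

lemma le_of_natPow_le {N K x y : ℕ} (hN : 0 < N) (hK : 0 < K)
    (h : N * 2 ^ x ≤ K * 2 ^ y) :
    Real.logb 2 N - Real.logb 2 K + x ≤ y := by
  have h' : (N : ℝ) * 2 ^ x ≤ K * 2 ^ y := by exact_mod_cast h
  have hN' : (0 : ℝ) < N := by exact_mod_cast hN
  have hK' : (0 : ℝ) < K := by exact_mod_cast hK
  have h2 := Real.logb_le_logb_of_le (b := 2) (by norm_num) (by positivity) h'
  rw [Real.logb_mul hN'.ne' (by positivity), Real.logb_mul hK'.ne' (by positivity),
    Real.logb_pow, Real.logb_pow, Real.logb_self_eq_one (by norm_num)] at h2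
  linarith

lemma rects_exponent_le {S₁ S₂ S₃ S₄ : Finset Pt} {a₁ a₂ a₃ a₄ j₁ j₂ C N : ℕ} {n : ℝ}
    (hN : 0 < N) (hn : n = Real.logb 2 N - Real.logb 2 (rectConst C))
    (h : N ≤ (rects S₁ S₂ S₃ S₄ a₁ a₂ a₃ a₄).card) (h1 : S₁.card ≤ 2 ^ j₁)
    (h2 : S₂.card ≤ 2 ^ j₂) (hl : 2 * a₁ ≤ j₁ + 2 * C) :
    (1 ≤ a₁ → n ≤ 2 * j₁ - 2 * a₁ + a₂ + a₄ ∧ n ≤ 2 * j₁ - 2 * a₁ + a₂ + a₃) ∧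
      n ≤ j₁ + j₂ + a₃ := by
  have hK : 0 < rectConst C := by
    rw [rectConst]; positivity
  refine ⟨fun ha => ⟨?_, ?_⟩, ?_⟩
  · have := card_rects_mul_pow_le ha h1 hl
      (fun p g hg => card_rectsAt_le_of_neighbors (S₁ := S₁) (S₂ := S₂) (S₃ := S₃) (S₄ := S₄)
        (a₁ := a₁) (a₂ := a₂) (a₃ := a₃) (a₄ := a₄) (p := p) hg)
    have h3 : N * 2 ^ (2 * a₁) ≤ rectConst C * 2 ^ (2 * j₁ + a₂ + a₄) := by
      refine (Nat.mul_le_mul_right _ h).trans (this.trans (le_of_eq ?_))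
      rw [rectConst]; ring
    have := le_of_natPow_le hN hK h3
    push_cast at this
    linarith
  · have := card_rects_mul_pow_le ha h1 hl
      (fun p g hg => card_rectsAt_le_of_path (S₁ := S₁) (S₂ := S₂) (S₃ := S₃) (S₄ := S₄)
        (a₁ := a₁) (a₂ := a₂) (a₃ := a₃) (a₄ := a₄) (p := p) hg)
    have h3 : N * 2 ^ (2 * a₁) ≤ rectConst C * 2 ^ (2 * j₁ + a₂ + a₃) := by
      refine (Nat.mul_le_mul_right _ h).trans (this.trans (le_of_eq ?_))
      rw [rectConst]; ring
    have := le_of_natPow_le hN hK h3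
    push_cast at this
    linarith
  · have h3 : N * 2 ^ 0 ≤ rectConst C * 2 ^ (j₁ + j₂ + a₃) := by
      calc N * 2 ^ 0 ≤ S₁.card * S₂.card * 2 ^ (a₃ + 1) := by
            rw [pow_zero, mul_one]
            exact h.trans (card_rects_le_of_side _ _ _ _ _ _ _ _)
        _ ≤ 2 ^ j₁ * 2 ^ j₂ * 2 ^ (a₃ + 1) := by gcongr
        _ = 2 * 2 ^ (j₁ + j₂ + a₃) := by ring
        _ ≤ _ := by
            gcongr
            rw [rectConst]
            omega
    have := le_of_natPow_le hN hK h3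
    push_cast at this
    linarith

theorem card_rects_le {S₁ S₂ S₃ S₄ : Finset Pt} {a₁ a₂ a₃ a₄ j₁ j₂ j₃ j₄ C : ℕ}
    (h1 : S₁.card ≤ 2 ^ j₁) (h2 : S₂.card ≤ 2 ^ j₂) (h3 : S₃.card ≤ 2 ^ j₃)
    (h4 : S₄.card ≤ 2 ^ j₄) (l1 : 2 * a₁ ≤ j₁ + 2 * C) (l2 : 2 * a₂ ≤ j₂ + 2 * C)
    (l3 : 2 * a₃ ≤ j₃ + 2 * C) (l4 : 2 * a₄ ≤ j₄ + 2 * C)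
    (h12 : a₁ = 0 ↔ a₂ = 0) (h34 : a₃ = 0 ↔ a₄ = 0) :
    ((rects S₁ S₂ S₃ S₄ a₁ a₂ a₃ a₄).card : ℝ) ≤ rectConst C *
      (2 : ℝ) ^ (((j₁ : ℝ) + j₂ + j₃ + j₄) / 2 - (|(j₁ : ℝ) - j₃| + |(j₂ : ℝ) - j₄| +
      (|(a₂ : ℝ) - a₁| + |(a₃ : ℝ) - a₁| + |(a₄ : ℝ) - a₁|)) / 32) := by
  rcases Nat.eq_zero_or_pos (rects S₁ S₂ S₃ S₄ a₁ a₂ a₃ a₄).card with h0 | hN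
  · rw [h0]
    simp only [Nat.cast_zero]
    positivity
  have hK : (0 : ℝ) < rectConst C := by
    rw [rectConst]; positivity
  have hN' : (0 : ℝ) < (rects S₁ S₂ S₃ S₄ a₁ a₂ a₃ a₄).card := by exact_mod_cast hN
  have r1 := card_rects_rotate S₁ S₂ S₃ S₄ a₁ a₂ a₃ a₄
  have r2 := r1.trans (card_rects_rotate S₂ S₃ S₄ S₁ a₂ a₃ a₄ a₁)
  have r3 := r2.trans (card_rects_rotate S₃ S₄ S₁ S₂ a₃ a₄ a₁ a₂)
  obtain ⟨n, hn⟩ : ∃ n, n = Real.logb 2 (rects S₁ S₂ S₃ S₄ a₁ a₂ a₃ a₄).card -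
    Real.logb 2 (rectConst C) := ⟨_, rfl⟩
  obtain ⟨b1, d1⟩ := rects_exponent_le hN hn le_rfl h1 h2 l1
  obtain ⟨b2, d2⟩ := rects_exponent_le hN hn r1 h2 h3 l2
  obtain ⟨b3, d3⟩ := rects_exponent_le hN hn r2 h3 h4 l3
  obtain ⟨b4, d4⟩ := rects_exponent_le hN hn r3 h4 h1 l4
  obtain ⟨c1, e1⟩ := rects_exponent_le hN hn (card_rects_reflect _ _ _ _ _ _ _ _) h1 h4 l1
  obtain ⟨c2, e2⟩ := rects_exponent_le hN hn (r1.trans (card_rects_reflect _ _ _ _ _ _ _ _)) h2 h1 l2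
  obtain ⟨c3, e3⟩ := rects_exponent_le hN hn (r2.trans (card_rects_reflect _ _ _ _ _ _ _ _)) h3 h2 l3
  obtain ⟨c4, e4⟩ := rects_exponent_le hN hn (r3.trans (card_rects_reflect _ _ _ _ _ _ _ _)) h4 h3 l4
  have key : n ≤ ((j₁ : ℝ) + j₂ + j₃ + j₄) / 2 - (|(j₁ : ℝ) - j₃| + |(j₂ : ℝ) - j₄| +
      (|(a₂ : ℝ) - a₁| + |(a₃ : ℝ) - a₁| + |(a₄ : ℝ) - a₁|)) / 32 := by
    rcases Nat.eq_zero_or_pos a₁ with z1 | p1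
    · have z2 := h12.1 z1
      subst z1 z2
      rcases Nat.eq_zero_or_pos a₃ with z3 | p3
      · have z4 := h34.1 z3
        subst z3 z4
        simp only [Nat.cast_zero, add_zero, sub_self, abs_zero] at *
        exact exponent_bound_of_poor d1 d2 d3 d4
      · have p4 : 1 ≤ a₄ := Nat.one_le_iff_ne_zero.2 fun h => p3.ne' (h34.2 h)
        have b3 := b3 p3
        have b4 := b4 p4
        have c3 := c3 p3
        have c4 := c4 p4
        simp only [Nat.cast_zero, add_zero, sub_zero, abs_zero, Nat.abs_cast] at *
        have := exponent_bound_of_mixed (n := n) (j₁ := j₃) (j₂ := j₄) (j₃ := j₁) (j₄ := j₂)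
          (a₁ := a₃) (a₂ := a₄) (by positivity) (by positivity) (by linarith) (by linarith)
          (by linarith) (by linarith) (by linarith) (by linarith)
        rw [abs_sub_comm (j₁ : ℝ), abs_sub_comm (j₂ : ℝ)]
        have := abs_nonneg ((a₃ : ℝ) - a₄)
        have : (0 : ℝ) ≤ a₃ := by positivity
        have : (0 : ℝ) ≤ a₄ := by positivity
        linarith
    · have p2 : 1 ≤ a₂ := Nat.one_le_iff_ne_zero.2 fun h => p1.ne' (h12.2 h)
      have b1 := b1 p1
      have b2 := b2 p2
      have c1 := c1 p1
      have c2 := c2 p2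
      rcases Nat.eq_zero_or_pos a₃ with z3 | p3
      · have z4 := h34.1 z3
        subst z3 z4
        simp only [Nat.cast_zero, add_zero, zero_sub, abs_neg, Nat.abs_cast] at *
        have := exponent_bound_of_mixed (n := n) (j₁ := j₁) (j₂ := j₂) (j₃ := j₃) (j₄ := j₄)
          (a₁ := a₁) (a₂ := a₂) (by positivity) (by positivity) (by linarith) (by linarith)
          (by linarith) (by linarith) (by linarith) (by linarith)
        rw [abs_sub_comm (a₂ : ℝ)]
        have : (0 : ℝ) ≤ a₂ := by positivity
        linarith
      · have p4 : 1 ≤ a₄ := Nat.one_le_iff_ne_zero.2 fun h => p3.ne' (h34.2 h)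
        have b3 := b3 p3
        have b4 := b4 p4
        have c3 := c3 p3
        have c4 := c4 p4
        apply exponent_bound_of_rich <;> linarith
  calc ((rects S₁ S₂ S₃ S₄ a₁ a₂ a₃ a₄).card : ℝ) = rectConst C * (2 : ℝ) ^ n := by
        rw [hn, Real.rpow_sub (by norm_num), Real.rpow_logb (by norm_num) (by norm_num) hN',
          Real.rpow_logb (by norm_num) (by norm_num) hK]
        field_simp
    _ ≤ _ := by
        gcongr
        norm_num

lemma sum_pairs_of_key_eq {α κ : Type*} [DecidableEq κ] (E : Finset α) (k : α → κ) (u : α → ℝ)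
    (I : Finset κ) (hI : ∀ e ∈ E, k e ∈ I) :
    ∑ x ∈ (E ×ˢ E).filter (fun x => k x.1 = k x.2), u x.1 * u x.2 =
      ∑ c ∈ I, (∑ e ∈ E.filter (fun e => k e = c), u e) ^ 2 := by
  rw [← Finset.sum_fiberwise_of_maps_to (t := I) (g := fun x => k x.1)]
  · refine Finset.sum_congr rfl fun c _ => ?_
    rw [sq, Finset.sum_mul_sum, ← Finset.sum_product']
    refine Finset.sum_congr ?_ fun _ _ => rfl
    ext x
    simp only [Finset.mem_filter, Finset.mem_product]
    constructor
    · rintro ⟨⟨⟨h1, h2⟩, h3⟩, h4⟩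
      exact ⟨⟨h1, h4⟩, h2, h3 ▸ h4⟩
    · rintro ⟨⟨h1, h4⟩, h2, h3⟩
      exact ⟨⟨⟨h1, h2⟩, h4.trans h3.symm⟩, h4⟩
  · intro x hx
    exact hI _ (Finset.mem_product.1 (Finset.mem_filter.1 hx).1).1

/-- Passing to pairs of a common type costs at most a factor given by the number of types. -/
lemma sum_pairs_le_card_mul_sum {α κ τ : Type*} [DecidableEq κ] [DecidableEq τ] [Fintype τ]
    (E : Finset α) (k : α → κ) (t : α → τ) (u : α → ℝ) :
    ∑ x ∈ (E ×ˢ E).filter (fun x => k x.1 = k x.2), u x.1 * u x.2 ≤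
      Fintype.card τ *
        ∑ x ∈ (E ×ˢ E).filter (fun x => (k x.1, t x.1) = (k x.2, t x.2)), u x.1 * u x.2 := by
  rw [sum_pairs_of_key_eq E k u (E.image k) (fun e he => Finset.mem_image_of_mem k he),
    sum_pairs_of_key_eq E (fun e => (k e, t e)) u (E.image k ×ˢ Finset.univ)
      (fun e he => Finset.mem_product.2 ⟨Finset.mem_image_of_mem k he, Finset.mem_univ _⟩),
    Finset.sum_product, Finset.mul_sum]
  refine Finset.sum_le_sum fun c _ => ?_
  rw [← Finset.sum_fiberwise (E.filter fun e => k e = c) t u]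
  refine sq_sum_le_card_mul_sum_sq.trans (le_of_eq ?_)
  rw [Finset.card_univ]
  simp only [Finset.filter_filter, Prod.mk.injEq]

/-- The product of the values of `f` at the vertices. -/
def quadProd (f : Pt → ℝ) (q : Pt × Pt × Pt × Pt) : ℝ := f q.1 * f q.2.1 * f q.2.2.1 * f q.2.2.2

lemma quadProd_nonneg {f : Pt → ℝ} (hf : ∀ p, 0 ≤ f p) (q : Pt × Pt × Pt × Pt) :
    0 ≤ quadProd f q :=
  mul_nonneg (mul_nonneg (mul_nonneg (hf _) (hf _)) (hf _)) (hf _)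

lemma sum_quadProd_le_of_injOn {f : Pt → ℝ} (P : Finset Pt)
    (W : Finset (Pt × Pt × Pt × Pt)) (hW : W ⊆ P ×ˢ P ×ˢ P ×ˢ P)
    (h13 : Set.InjOn (fun q : Pt × Pt × Pt × Pt => (q.1, q.2.2.1)) W)
    (h24 : Set.InjOn (fun q : Pt × Pt × Pt × Pt => (q.2.1, q.2.2.2)) W) :
    ∑ q ∈ W, quadProd f q ≤ (∑ p ∈ P, f p ^ 2) ^ 2 := by
  classical
  have hsq : (∑ p ∈ P, f p ^ 2) ^ 2 = ∑ x ∈ P ×ˢ P, f x.1 ^ 2 * f x.2 ^ 2 := by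
    rw [sq, Finset.sum_mul_sum, ← Finset.sum_product']
  have key (φ : Pt × Pt × Pt × Pt → Pt × Pt) (hφ : Set.InjOn φ W)
      (hm : ∀ q ∈ W, φ q ∈ P ×ˢ P) :
      ∑ q ∈ W, f (φ q).1 ^ 2 * f (φ q).2 ^ 2 ≤ (∑ p ∈ P, f p ^ 2) ^ 2 := by
    rw [hsq, ← Finset.sum_image (g := φ) (f := fun x => f x.1 ^ 2 * f x.2 ^ 2) hφ]
    refine Finset.sum_le_sum_of_subset_of_nonneg ?_ fun _ _ _ => by positivity
    exact Finset.image_subset_iff.2 hm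
  have hm (q) (hq : q ∈ W) := hW hq
  simp only [Finset.mem_product] at hm
  have k1 := key _ h13 fun q hq => Finset.mem_product.2 ⟨(hm q hq).1, (hm q hq).2.2.1⟩
  have k2 := key _ h24 fun q hq => Finset.mem_product.2 ⟨(hm q hq).2.1, (hm q hq).2.2.2⟩
  have : ∑ q ∈ W, quadProd f q ≤ ∑ q ∈ W, (f q.1 ^ 2 * f q.2.2.1 ^ 2 +
      f q.2.1 ^ 2 * f q.2.2.2 ^ 2) / 2 := by
    refine Finset.sum_le_sum fun q _ => ?_
    rw [quadProd]
    nlinarith [sq_nonneg (f q.1 * f q.2.2.1 - f q.2.1 * f q.2.2.2)]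
  rw [← Finset.sum_div, Finset.sum_add_distrib] at this
  linarith

/-- A rectangle is determined by two opposite vertices and the line spanned by a side. -/
lemma eq_of_parallel_sides {p₁ p₂ p₃ p₄ r₂ r₄ : Pt} (hp : p₁ + p₃ = p₂ + p₄)
    (hr : p₁ + p₃ = r₂ + r₄) (hpd : dotProd (p₂ - p₁) (p₄ - p₁) = 0)
    (hrd : dotProd (r₂ - p₁) (r₄ - p₁) = 0) (hp0 : p₄ ≠ p₁) (hr0 : r₄ ≠ p₁)
    (h : crossProd (p₄ - p₁) (r₄ - p₁) = 0) : p₂ = r₂ ∧ p₄ = r₄ := by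
  have hp2 : p₂ - p₁ = (p₃ - p₁) - (p₄ - p₁) := by
    rw [sub_sub_sub_cancel_right, sub_eq_sub_iff_add_eq_add, ← hp, add_comm]
  have hr2 : r₂ - p₁ = (p₃ - p₁) - (r₄ - p₁) := by
    rw [sub_sub_sub_cancel_right, sub_eq_sub_iff_add_eq_add, ← hr, add_comm]
  rw [hp2] at hpd
  rw [hr2] at hrd
  have h4 : p₄ = r₄ := by
    rw [← sub_ne_zero] at hp0 hr0
    rw [← sub_left_inj (a := p₁)]
    generalize p₄ - p₁ = d at *
    generalize r₄ - p₁ = e at *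
    generalize p₃ - p₁ = v at *
    obtain ⟨d1, d2⟩ := d
    obtain ⟨e1, e2⟩ := e
    obtain ⟨v1, v2⟩ := v
    simp only [dotProd, crossProd, Prod.fst_sub, Prod.snd_sub] at *
    have pos {x y : ℤ} (h : (x, y) ≠ (0 : Pt)) : x * x + y * y ≠ 0 := by
      intro h0
      refine h (Prod.ext ?_ ?_)
      · exact mul_self_eq_zero.1 (by nlinarith [mul_self_nonneg x, mul_self_nonneg y])
      · exact mul_self_eq_zero.1 (by nlinarith [mul_self_nonneg x, mul_self_nonneg y])
    have f1 : e1 * v1 + e2 * v2 = d1 * e1 + d2 * e2 := by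
      refine mul_left_cancel₀ (pos hp0) ?_
      linear_combination (d1 * e1 + d2 * e2) * hpd + (d1 * v2 - d2 * v1) * h
    have f2 : d1 * v1 + d2 * v2 = d1 * e1 + d2 * e2 := by
      refine mul_left_cancel₀ (pos hr0) ?_
      linear_combination (d1 * e1 + d2 * e2) * hrd - (e1 * v2 - e2 * v1) * h
    have f3 : (d1 - e1) * (d1 - e1) + (d2 - e2) * (d2 - e2) = 0 := by
      linear_combination f1 + f2 - hpd - hrd
    by_contra hne
    refine pos (x := d1 - e1) (y := d2 - e2) (fun h0 => hne ?_) f3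
    rw [Prod.mk_eq_zero] at h0
    exact Prod.ext (sub_eq_zero.1 h0.1) (sub_eq_zero.1 h0.2)
  subst h4
  rw [hp] at hr
  exact ⟨add_right_cancel hr, rfl⟩

lemma injOn_fst_thd {W : Finset (Pt × Pt × Pt × Pt)} (hW : ∀ q ∈ W, IsProperRect q)
    (h : ∀ q ∈ W, ∀ r ∈ W, q.1 = r.1 → q.2.2.1 = r.2.2.1 →
      crossProd (q.2.2.2 - q.1) (r.2.2.2 - r.1) = 0) :
    Set.InjOn (fun q : Pt × Pt × Pt × Pt => (q.1, q.2.2.1)) W := by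
  rintro ⟨p₁, p₂, p₃, p₄⟩ hq ⟨r₁, r₂, r₃, r₄⟩ hr heq
  simp only [Prod.mk.injEq] at heq
  have := h _ hq _ hr heq.1 heq.2
  obtain ⟨a1, a2, a3, a4⟩ := hW _ hq
  obtain ⟨b1, b2, b3, b4⟩ := hW _ hr
  obtain ⟨rfl, rfl⟩ := heq
  obtain ⟨rfl, rfl⟩ := eq_of_parallel_sides a1 b1 a2 b2 a4 b4 this
  rfl

lemma injOn_snd_fth {W : Finset (Pt × Pt × Pt × Pt)} (hW : ∀ q ∈ W, IsProperRect q)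
    (h : ∀ q ∈ W, ∀ r ∈ W, q.2.1 = r.2.1 → q.2.2.2 = r.2.2.2 →
      crossProd (q.2.2.2 - q.1) (r.2.2.2 - r.1) = 0) :
    Set.InjOn (fun q : Pt × Pt × Pt × Pt => (q.2.1, q.2.2.2)) W := by
  have aux {p₁ p₂ p₃ p₄ : Pt} (hp : p₁ + p₃ = p₂ + p₄)
      (hd : dotProd (p₂ - p₁) (p₄ - p₁) = 0) (hn : p₄ ≠ p₁) :
      p₃ - p₂ = p₄ - p₁ ∧ dotProd (p₁ - p₂) (p₃ - p₂) = 0 ∧ p₃ ≠ p₂ := by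
    have h32 : p₃ - p₂ = p₄ - p₁ := by
      rw [sub_eq_sub_iff_add_eq_add, add_comm, hp, add_comm]
    refine ⟨h32, ?_, ?_⟩
    · rw [h32]
      simp only [dotProd, Prod.fst_sub, Prod.snd_sub] at hd ⊢
      linarith
    · rw [← sub_ne_zero, h32, sub_ne_zero]
      exact hn
  rintro ⟨p₁, p₂, p₃, p₄⟩ hq ⟨r₁, r₂, r₃, r₄⟩ hr heq
  simp only [Prod.mk.injEq] at heq
  have := h _ hq _ hr heq.1 heq.2
  obtain ⟨a1, a2, a3, a4⟩ := hW _ hq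
  obtain ⟨b1, b2, b3, b4⟩ := hW _ hr
  obtain ⟨rfl, rfl⟩ := heq
  obtain ⟨a5, a6, a7⟩ := aux a1 a2 a4
  obtain ⟨b5, b6, b7⟩ := aux b1 b2 b4
  simp only at a1 b1 a5 b5 a6 b6 a7 b7 this
  rw [← a5, ← b5] at this
  obtain ⟨rfl, rfl⟩ := eq_of_parallel_sides a1.symm b1.symm a6 b6 a7 b7 this
  rfl

lemma sum_le_add_of_subset_union {α : Type*} [DecidableEq α] {A B D : Finset α} {F : α → ℝ}
    (hF : ∀ x, 0 ≤ F x) (h : A ⊆ B ∪ D) : ∑ x ∈ A, F x ≤ ∑ x ∈ B, F x + ∑ x ∈ D, F x := by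
  rw [← Finset.sum_union_inter]
  have h1 := Finset.sum_le_sum_of_subset_of_nonneg h fun x _ _ => hF x
  have h2 : 0 ≤ ∑ x ∈ B ∩ D, F x := Finset.sum_nonneg fun x _ => hF x
  linarith

open Classical in
/-- All rectangles with vertices in `P`, including the degenerate ones. -/
def allRects (P : Finset Pt) : Finset (Pt × Pt × Pt × Pt) :=
  (P ×ˢ P ×ˢ P ×ˢ P).filter fun q =>
    q.1 + q.2.2.1 = q.2.1 + q.2.2.2 ∧ dotProd (q.2.1 - q.1) (q.2.2.2 - q.1) = 0

open Classical in
/-- Nondegenerate rectangles for which the types of the endpoints of the two opposite sides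
agree and are at least `2`. -/
def lightRects (P : Finset Pt) (vt : Pt → Pt → Fin 4) : Finset (Pt × Pt × Pt × Pt) :=
  (P ×ˢ P ×ˢ P ×ˢ P).filter fun q => IsProperRect q ∧
    (vt q.1 (q.2.2.2 - q.1) = vt q.2.1 (q.2.2.2 - q.1) ∧
      vt q.2.2.2 (q.2.2.2 - q.1) = vt q.2.2.1 (q.2.2.2 - q.1)) ∧
    2 ≤ vt q.1 (q.2.2.2 - q.1) ∧ 2 ≤ vt q.2.2.2 (q.2.2.2 - q.1)

open Classical in
/-- The rectangles in `allRects P` whose opposite sides have the same types. -/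
def sameTypeRects (P : Finset Pt) (vt : Pt → Pt → Fin 4) : Finset (Pt × Pt × Pt × Pt) :=
  (allRects P).filter fun q => vt q.1 (q.2.2.2 - q.1) = vt q.2.1 (q.2.2.2 - q.1) ∧
      vt q.2.2.2 (q.2.2.2 - q.1) = vt q.2.2.1 (q.2.2.2 - q.1)

lemma sum_allRects_le_sameType (P : Finset Pt) (f : Pt → ℝ) (vt : Pt → Pt → Fin 4) :
    ∑ q ∈ allRects P, quadProd f q ≤ 16 * ∑ q ∈ sameTypeRects P vt, quadProd f q := by
  classical
  let k : Pt × Pt → Pt × ℤ := fun e => (e.2 - e.1, dotProd (e.2 - e.1) e.1)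
  let t : Pt × Pt → Fin 4 × Fin 4 := fun e => (vt e.1 (e.2 - e.1), vt e.2 (e.2 - e.1))
  have h := sum_pairs_le_card_mul_sum (P ×ˢ P) k t (fun e => f e.1 * f e.2)
  have hk (p₁ p₂ p₃ p₄ : Pt) : k (p₁, p₄) = k (p₂, p₃) ↔
      p₁ + p₃ = p₂ + p₄ ∧ dotProd (p₂ - p₁) (p₄ - p₁) = 0 := by
    simp only [k, Prod.mk.injEq]
    have e1 : p₄ - p₁ = p₃ - p₂ ↔ p₁ + p₃ = p₂ + p₄ := by
      rw [sub_eq_sub_iff_add_eq_add, add_comm p₁, add_comm p₂, eq_comm]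
    rw [e1]
    refine and_congr_right fun h => ?_
    rw [← e1.2 h]
    simp only [dotProd, Prod.fst_sub, Prod.snd_sub]
    constructor <;> intro h <;> linarith
  have h1 : ∑ x ∈ ((P ×ˢ P) ×ˢ (P ×ˢ P)).filter (fun x => k x.1 = k x.2),
      f x.1.1 * f x.1.2 * (f x.2.1 * f x.2.2) = ∑ q ∈ allRects P, quadProd f q := by
    refine Finset.sum_bij' (fun x _ => (x.1.1, x.2.1, x.2.2, x.1.2))
      (fun q _ => ((q.1, q.2.2.2), (q.2.1, q.2.2.1))) ?_ ?_ (fun _ _ => rfl) (fun _ _ => rfl) ?_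
    · rintro ⟨⟨p₁, p₄⟩, p₂, p₃⟩ hx
      simp only [Finset.mem_filter, Finset.mem_product, allRects, hk] at hx ⊢
      tauto
    · rintro ⟨p₁, p₂, p₃, p₄⟩ hx
      simp only [Finset.mem_filter, Finset.mem_product, allRects, hk] at hx ⊢
      tauto
    · intro x _
      simp only [quadProd]
      ring
  have h2 : ∑ x ∈ ((P ×ˢ P) ×ˢ (P ×ˢ P)).filter (fun x => (k x.1, t x.1) = (k x.2, t x.2)),
      f x.1.1 * f x.1.2 * (f x.2.1 * f x.2.2) = ∑ q ∈ sameTypeRects P vt, quadProd f q := by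
    have h32 {p₁ p₂ p₃ p₄ : Pt} (hp : p₁ + p₃ = p₂ + p₄) : p₃ - p₂ = p₄ - p₁ := by
      rw [sub_eq_sub_iff_add_eq_add, add_comm, hp, add_comm]
    refine Finset.sum_bij' (fun x _ => (x.1.1, x.2.1, x.2.2, x.1.2))
      (fun q _ => ((q.1, q.2.2.2), (q.2.1, q.2.2.1))) ?_ ?_ (fun _ _ => rfl) (fun _ _ => rfl) ?_
    · rintro ⟨⟨p₁, p₄⟩, p₂, p₃⟩ hx
      simp only [Finset.mem_filter, Finset.mem_product, sameTypeRects, allRects, Prod.mk.injEq,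
        hk, t] at hx ⊢
      rw [h32 hx.2.1.1] at hx
      tauto
    · rintro ⟨p₁, p₂, p₃, p₄⟩ hx
      simp only [Finset.mem_filter, Finset.mem_product, sameTypeRects, allRects, Prod.mk.injEq,
        hk, t] at hx ⊢
      rw [h32 hx.1.2.1]
      tauto
    · intro x _
      simp only [quadProd]
      ring
  rw [h1, h2] at h
  simpa using h

/-- Reduction to light rectangles: a rectangle with a vertex on a heavy line is determined by
either pair of opposite vertices. -/
theorem sum_allRects_le {P : Finset Pt} {f : Pt → ℝ} (hf : ∀ p, 0 ≤ f p)
    {vt : Pt → Pt → Fin 4} (hvt : ∀ p ∈ P, ∀ d e : Pt, d ≠ 0 → e ≠ 0 →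
      vt p d = vt p e → vt p d < 2 → crossProd d e = 0) :
    ∑ q ∈ allRects P, quadProd f q ≤
      16 * (6 * (∑ p ∈ P, f p ^ 2) ^ 2 + ∑ q ∈ lightRects P vt, quadProd f q) := by
  classical
  refine (sum_allRects_le_sameType P f vt).trans ?_
  set X := P ×ˢ P ×ˢ P ×ˢ P with hX
  set Λ := (∑ p ∈ P, f p ^ 2) ^ 2 with hΛ
  have hF := quadProd_nonneg hf
  let W (i : Fin 4) := X.filter fun q => IsProperRect q ∧ vt q.1 (q.2.2.2 - q.1) = i ∧
    vt q.2.1 (q.2.2.2 - q.1) = i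
  let W' (i : Fin 4) := X.filter fun q => IsProperRect q ∧ vt q.2.2.2 (q.2.2.2 - q.1) = i ∧
    vt q.2.2.1 (q.2.2.2 - q.1) = i
  let D := X.filter fun q => q.1 = q.2.2.2 ∧ q.2.1 = q.2.2.1
  let D' := X.filter fun q => q.1 = q.2.1 ∧ q.2.2.1 = q.2.2.2
  have hd {q : Pt × Pt × Pt × Pt} (h : IsProperRect q) : q.2.2.2 - q.1 ≠ 0 :=
    sub_ne_zero.2 h.2.2.2
  have bW (i : Fin 4) (hi : i < 2) : ∑ q ∈ W i, quadProd f q ≤ Λ := by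
    refine sum_quadProd_le_of_injOn P _ (Finset.filter_subset _ _)
      (injOn_fst_thd (fun q hq => (Finset.mem_filter.1 hq).2.1) ?_)
      (injOn_snd_fth (fun q hq => (Finset.mem_filter.1 hq).2.1) ?_)
    · intro q hq r hr h _
      simp only [W, hX, Finset.mem_filter, Finset.mem_product] at hq hr
      refine hvt q.1 hq.1.1 _ _ (hd hq.2.1) (hd hr.2.1) ?_ (hq.2.2.1 ▸ hi)
      rw [hq.2.2.1, ← hr.2.2.1, h]
    · intro q hq r hr h _
      simp only [W, hX, Finset.mem_filter, Finset.mem_product] at hq hr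
      refine hvt q.2.1 hq.1.2.1 _ _ (hd hq.2.1) (hd hr.2.1) ?_ (hq.2.2.2 ▸ hi)
      rw [hq.2.2.2, ← hr.2.2.2, h]
  have bW' (i : Fin 4) (hi : i < 2) : ∑ q ∈ W' i, quadProd f q ≤ Λ := by
    refine sum_quadProd_le_of_injOn P _ (Finset.filter_subset _ _)
      (injOn_fst_thd (fun q hq => (Finset.mem_filter.1 hq).2.1) ?_)
      (injOn_snd_fth (fun q hq => (Finset.mem_filter.1 hq).2.1) ?_)
    · intro q hq r hr _ h
      simp only [W', hX, Finset.mem_filter, Finset.mem_product] at hq hr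
      refine hvt q.2.2.1 hq.1.2.2.1 _ _ (hd hq.2.1) (hd hr.2.1) ?_ (hq.2.2.2 ▸ hi)
      rw [hq.2.2.2, ← hr.2.2.2, h]
    · intro q hq r hr _ h
      simp only [W', hX, Finset.mem_filter, Finset.mem_product] at hq hr
      refine hvt q.2.2.2 hq.1.2.2.2 _ _ (hd hq.2.1) (hd hr.2.1) ?_ (hq.2.2.1 ▸ hi)
      rw [hq.2.2.1, ← hr.2.2.1, h]
  have bD : ∑ q ∈ D, quadProd f q ≤ Λ := by
    refine sum_quadProd_le_of_injOn P _ (Finset.filter_subset _ _) ?_ ?_ <;>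
    · rintro ⟨p₁, p₂, p₃, p₄⟩ hq ⟨r₁, r₂, r₃, r₄⟩ hr h
      simp only [D, Finset.coe_filter, Set.mem_ofPred_eq, Prod.mk.injEq] at hq hr h ⊢
      obtain ⟨-, rfl, rfl⟩ := hq
      obtain ⟨-, rfl, rfl⟩ := hr
      tauto
  have bD' : ∑ q ∈ D', quadProd f q ≤ Λ := by
    refine sum_quadProd_le_of_injOn P _ (Finset.filter_subset _ _) ?_ ?_ <;>
    · rintro ⟨p₁, p₂, p₃, p₄⟩ hq ⟨r₁, r₂, r₃, r₄⟩ hr h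
      simp only [D', Finset.coe_filter, Set.mem_ofPred_eq, Prod.mk.injEq] at hq hr h ⊢
      obtain ⟨-, rfl, rfl⟩ := hq
      obtain ⟨-, rfl, rfl⟩ := hr
      tauto
  have hsub : sameTypeRects P vt ⊆
      D ∪ (D' ∪ (W 0 ∪ (W 1 ∪ (W' 0 ∪ (W' 1 ∪ lightRects P vt))))) := by
    rintro ⟨p₁, p₂, p₃, p₄⟩ hq
    simp only [sameTypeRects, allRects, Finset.mem_filter] at hq
    obtain ⟨⟨hP, hp, ho⟩, t1, t2⟩ := hq
    simp only [D, D', W, W', lightRects, Finset.mem_union, Finset.mem_filter]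
    by_cases h41 : p₄ = p₁
    · subst h41
      rw [add_comm] at hp
      exact Or.inl ⟨hP, rfl, (add_right_cancel hp).symm⟩
    refine Or.inr ?_
    by_cases h21 : p₂ = p₁
    · subst h21
      exact Or.inl ⟨hP, rfl, add_left_cancel hp⟩
    refine Or.inr ?_
    have hpr : IsProperRect (p₁, p₂, p₃, p₄) := ⟨hp, ho, h21, h41⟩
    by_cases c0 : vt p₁ (p₄ - p₁) = 0
    · exact Or.inl ⟨hP, hpr, c0, t1 ▸ c0⟩
    refine Or.inr ?_
    by_cases c1 : vt p₁ (p₄ - p₁) = 1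
    · exact Or.inl ⟨hP, hpr, c1, t1 ▸ c1⟩
    refine Or.inr ?_
    by_cases c2 : vt p₄ (p₄ - p₁) = 0
    · exact Or.inl ⟨hP, hpr, c2, t2 ▸ c2⟩
    refine Or.inr ?_
    by_cases c3 : vt p₄ (p₄ - p₁) = 1
    · exact Or.inl ⟨hP, hpr, c3, t2 ▸ c3⟩
    refine Or.inr ⟨hP, hpr, ⟨t1, t2⟩, ?_, ?_⟩
    · omega
    · omega
  have s1 := sum_le_add_of_subset_union hF hsub
  have s2 := sum_le_add_of_subset_union hF
    (Finset.Subset.refl (D' ∪ (W 0 ∪ (W 1 ∪ (W' 0 ∪ (W' 1 ∪ lightRects P vt))))))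
  have s3 := sum_le_add_of_subset_union hF
    (Finset.Subset.refl (W 0 ∪ (W 1 ∪ (W' 0 ∪ (W' 1 ∪ lightRects P vt)))))
  have s4 := sum_le_add_of_subset_union hF
    (Finset.Subset.refl (W 1 ∪ (W' 0 ∪ (W' 1 ∪ lightRects P vt))))
  have s5 := sum_le_add_of_subset_union hF
    (Finset.Subset.refl (W' 0 ∪ (W' 1 ∪ lightRects P vt)))
  have s6 := sum_le_add_of_subset_union hF (Finset.Subset.refl (W' 1 ∪ lightRects P vt))
  have b0 := bW 0 (by decide)
  have b1 := bW 1 (by decide)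
  have b0' := bW' 0 (by decide)
  have b1' := bW' 1 (by decide)
  linarith

/-- An exponentially decaying kernel on the natural numbers. -/
def decay (x y : ℕ) : ℝ := (2 : ℝ) ^ (-|(x : ℝ) - y| / 32)

/-- A bound for the sums of `decay`. -/
def decaySum : ℝ := 2 * (1 - (2 : ℝ) ^ (-(1 : ℝ) / 32))⁻¹

lemma decay_nonneg (x y : ℕ) : 0 ≤ decay x y := by
  rw [decay]; positivity

lemma decay_comm (x y : ℕ) : decay x y = decay y x := by
  rw [decay, decay, abs_sub_comm]

lemma decay_eq_pow {x y k : ℕ} (h : x = y + k) : decay x y = ((2 : ℝ) ^ (-(1 : ℝ) / 32)) ^ k := by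
  subst h
  rw [decay, ← Real.rpow_natCast, ← Real.rpow_mul (by norm_num)]
  congr 1
  push_cast
  rw [add_sub_cancel_left, abs_of_nonneg (by positivity)]
  ring

lemma decay_ratio_lt_one : (2 : ℝ) ^ (-(1 : ℝ) / 32) < 1 :=
  Real.rpow_lt_one_of_one_lt_of_neg (by norm_num) (by norm_num)

lemma decaySum_pos : 0 < decaySum := by
  have := decay_ratio_lt_one
  rw [decaySum]
  have : 0 < 1 - (2 : ℝ) ^ (-(1 : ℝ) / 32) := by linarith
  positivity

lemma sum_decay_le (s : Finset ℕ) (x : ℕ) : ∑ y ∈ s, decay y x ≤ decaySum := by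
  set r := (2 : ℝ) ^ (-(1 : ℝ) / 32) with hr
  have hr0 : 0 ≤ r := by positivity
  have hsum : Summable fun k : ℕ => r ^ k := summable_geometric_of_lt_one hr0 decay_ratio_lt_one
  have aux (t : Finset ℕ) (φ : ℕ → ℕ) (hφ : Set.InjOn φ t) (h : ∀ y ∈ t, decay y x = r ^ φ y) :
      ∑ y ∈ t, decay y x ≤ (1 - r)⁻¹ := by
    rw [Finset.sum_congr rfl h, ← Finset.sum_image (f := fun k => r ^ k) hφ,
      ← tsum_geometric_of_lt_one hr0 decay_ratio_lt_one]
    exact hsum.sum_le_tsum _ fun _ _ => by positivity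
  rw [← Finset.sum_filter_add_sum_filter_not s (fun y => y ≤ x), decaySum, two_mul]
  refine add_le_add (aux _ (fun y => x - y) ?_ ?_) (aux _ (fun y => y - x) ?_ ?_)
  · intro y hy z hz h
    simp only [Finset.coe_filter, Set.mem_ofPred_eq] at hy hz h
    omega
  · intro y hy
    rw [decay_comm]
    have := (Finset.mem_filter.1 hy).2
    exact decay_eq_pow (by omega)
  · intro y hy z hz h
    simp only [Finset.coe_filter, Set.mem_ofPred_eq] at hy hz h
    omega
  · intro y hy
    have := (Finset.mem_filter.1 hy).2
    exact decay_eq_pow (by omega)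

lemma sum_mul_mul_decay_le (s : Finset ℕ) (l : ℕ → ℝ) :
    ∑ x ∈ s ×ˢ s, l x.1 * l x.2 * decay x.1 x.2 ≤ decaySum * ∑ j ∈ s, l j ^ 2 := by
  have h1 : ∑ x ∈ s ×ˢ s, l x.2 ^ 2 * decay x.1 x.2 ≤ decaySum * ∑ j ∈ s, l j ^ 2 := by
    rw [Finset.sum_product_right, Finset.mul_sum]
    refine Finset.sum_le_sum fun y _ => ?_
    dsimp only
    rw [← Finset.mul_sum, mul_comm]
    exact mul_le_mul_of_nonneg_right (sum_decay_le s y) (sq_nonneg _)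
  have h2 : ∑ x ∈ s ×ˢ s, l x.1 ^ 2 * decay x.1 x.2 ≤ decaySum * ∑ j ∈ s, l j ^ 2 := by
    rw [Finset.sum_product, Finset.mul_sum]
    refine Finset.sum_le_sum fun y _ => ?_
    simp only [decay_comm y]
    rw [← Finset.mul_sum, mul_comm]
    exact mul_le_mul_of_nonneg_right (sum_decay_le s y) (sq_nonneg _)
  have h3 : ∑ x ∈ s ×ˢ s, l x.1 * l x.2 * decay x.1 x.2 ≤
      ∑ x ∈ s ×ˢ s, (l x.1 ^ 2 * decay x.1 x.2 + l x.2 ^ 2 * decay x.1 x.2) / 2 := by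
    refine Finset.sum_le_sum fun x _ => ?_
    nlinarith [mul_nonneg (sq_nonneg (l x.1 - l x.2)) (decay_nonneg x.1 x.2)]
  rw [← Finset.sum_div, Finset.sum_add_distrib] at h3
  linarith

/-- Summation of the bounds for the individual classes of light rectangles. -/
lemma sum_decay_classes_le (s t : Finset ℕ) {l : ℕ → ℝ} (hl : ∀ j ∈ s, 0 ≤ l j) :
    ∑ i ∈ ((s ×ˢ s) ×ˢ (s ×ˢ s)) ×ˢ (t ×ˢ t ×ˢ t ×ˢ t),
      (l i.1.1.1 * l i.1.1.2 * decay i.1.1.1 i.1.1.2) *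
      (l i.1.2.1 * l i.1.2.2 * decay i.1.2.1 i.1.2.2) *
      (decay i.2.2.1 i.2.1 * decay i.2.2.2.1 i.2.1 * decay i.2.2.2.2 i.2.1) ≤
    decaySum ^ 5 * t.card * (∑ j ∈ s, l j ^ 2) ^ 2 := by
  have hG := decaySum_pos
  have ht : ∑ a ∈ t ×ˢ t ×ˢ t ×ˢ t, decay a.2.1 a.1 * decay a.2.2.1 a.1 * decay a.2.2.2 a.1 ≤
      t.card * decaySum ^ 3 := by
    rw [Finset.sum_product, ← nsmul_eq_mul]
    refine Finset.sum_le_card_nsmul _ _ _ fun a _ => ?_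
    have : ∑ x ∈ t ×ˢ t ×ˢ t, decay x.1 a * decay x.2.1 a * decay x.2.2 a =
        (∑ x ∈ t, decay x a) ^ 3 := by
      simp only [Finset.sum_product, ← Finset.mul_sum, mul_assoc, ← Finset.sum_mul]
      ring
    rw [this]
    exact pow_le_pow_left₀ (Finset.sum_nonneg fun x _ => decay_nonneg _ _) (sum_decay_le t a) 3
  have hs := sum_mul_mul_decay_le s l
  have hs0 : 0 ≤ ∑ x ∈ s ×ˢ s, l x.1 * l x.2 * decay x.1 x.2 := by
    refine Finset.sum_nonneg fun x hx => ?_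
    rw [Finset.mem_product] at hx
    exact mul_nonneg (mul_nonneg (hl _ hx.1) (hl _ hx.2)) (decay_nonneg _ _)
  rw [Finset.sum_product]
  simp only [← Finset.mul_sum]
  rw [← Finset.sum_mul, Finset.sum_product]
  simp only [← Finset.mul_sum]
  rw [← Finset.sum_mul, ← sq]
  calc _ ≤ (decaySum * ∑ j ∈ s, l j ^ 2) ^ 2 * (t.card * decaySum ^ 3) :=
        mul_le_mul (pow_le_pow_left₀ hs0 hs 2) ht (Finset.sum_nonneg fun a _ =>
          mul_nonneg (mul_nonneg (decay_nonneg _ _) (decay_nonneg _ _)) (decay_nonneg _ _))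
          (sq_nonneg _)
    _ = _ := by ring

open Classical in
/-- The type of the vertex `p` with respect to a side of direction `d`: `0` or `1` if the line
along `d`, respectively along `perp d`, is heavy; otherwise `2` or `3` according to whether the
dyadic size of `crossCount` is trivial. -/
def sideType (S : ℕ → Finset Pt) (J : Pt → ℕ) (C : ℕ) (p d : Pt) : Fin 4 :=
  if 2 ^ (J p + 2 * C) ≤ (ptsOn (S (J p)) p d).card ^ 2 then 0
  else if 2 ^ (J p + 2 * C) ≤ (ptsOn (S (J p)) p (perp d)).card ^ 2 then 1
  else if Nat.log 2 (crossCount (S (J p)) p d) = 0 then 2 else 3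

lemma two_le_sideType {S : ℕ → Finset Pt} {J : Pt → ℕ} {C : ℕ} {p d : Pt}
    (h : 2 ≤ sideType S J C p d) :
    crossCount (S (J p)) p d ^ 2 < 2 ^ (J p + 2 * C) ∧
      (Nat.log 2 (crossCount (S (J p)) p d) = 0 ↔ sideType S J C p d = 2) := by
  rw [sideType] at h ⊢
  split_ifs at h ⊢ with h1 h2 h3
  · exact absurd h (by decide)
  · exact absurd h (by decide)
  · refine ⟨?_, by simp [h3]⟩
    rcases max_choice (ptsOn (S (J p)) p d).card (ptsOn (S (J p)) p (perp d)).card with e | e <;>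
    · rw [crossCount, e]
      omega
  · refine ⟨?_, by simp [h3]⟩
    rcases max_choice (ptsOn (S (J p)) p d).card (ptsOn (S (J p)) p (perp d)).card with e | e <;>
    · rw [crossCount, e]
      omega

lemma log_crossCount_le {S : Finset Pt} {p d : Pt} {j C : ℕ} (hp : p ∈ S)
    (h : crossCount S p d ^ 2 < 2 ^ (j + 2 * C)) :
    2 * Nat.log 2 (crossCount S p d) ≤ j + 2 * C := by
  have h1 := Nat.pow_log_le_self 2 (crossCount_pos hp d).ne'
  have h2 : 2 ^ (2 * Nat.log 2 (crossCount S p d)) < 2 ^ (j + 2 * C) := by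
    refine lt_of_le_of_lt ?_ h
    rw [pow_mul']
    exact Nat.pow_le_pow_left h1 2
  exact ((Nat.pow_lt_pow_iff_right (by norm_num)).1 h2).le

lemma rpow_sum_eq_decay (j₁ j₂ j₃ j₄ a₁ a₂ a₃ a₄ : ℕ) :
    (2 : ℝ) ^ (((j₁ : ℝ) + j₂ + j₃ + j₄) / 2 - (|(j₁ : ℝ) - j₃| + |(j₂ : ℝ) - j₄| +
      (|(a₂ : ℝ) - a₁| + |(a₃ : ℝ) - a₁| + |(a₄ : ℝ) - a₁|)) / 32) *
      ((2 : ℝ) ^ (-(j₁ : ℝ) / 2) * (2 : ℝ) ^ (-(j₂ : ℝ) / 2) * (2 : ℝ) ^ (-(j₃ : ℝ) / 2) *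
        (2 : ℝ) ^ (-(j₄ : ℝ) / 2)) =
      decay j₁ j₃ * decay j₂ j₄ * (decay a₂ a₁ * decay a₃ a₁ * decay a₄ a₁) := by
  simp only [decay, ← Real.rpow_add (by norm_num : (0 : ℝ) < 2)]
  congr 1
  ring

section

variable {S : ℕ → Finset Pt} {J : Pt → ℕ} {lam : ℕ → ℝ} {f : Pt → ℝ} {C m : ℕ} {P : Finset Pt}

/-- The contribution of a single class of light rectangles. -/
lemma sum_lightRects_class_le (hlam : ∀ j ≤ m, 0 ≤ lam j) (hS : ∀ j ≤ m, (S j).card ≤ 2 ^ j)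
    (hJ : ∀ p ∈ P, p ∈ S (J p))
    (hf : ∀ p ∈ P, f p = lam (J p) * (2 : ℝ) ^ (-(J p : ℝ) / 2))
    {j₁ j₂ j₃ j₄ a₁ a₂ a₃ a₄ : ℕ} (h1 : j₁ ≤ m) (h2 : j₂ ≤ m) (h3 : j₃ ≤ m) (h4 : j₄ ≤ m)
    {B : Finset (Pt × Pt × Pt × Pt)} (hB : ∀ q ∈ B, q ∈ lightRects P (sideType S J C) ∧
      (J q.1 = j₁ ∧ J q.2.1 = j₂ ∧ J q.2.2.1 = j₃ ∧ J q.2.2.2 = j₄) ∧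
      Nat.log 2 (crossCount (S (J q.1)) q.1 (q.2.2.2 - q.1)) = a₁ ∧
      Nat.log 2 (crossCount (S (J q.2.1)) q.2.1 (q.2.2.2 - q.1)) = a₂ ∧
      Nat.log 2 (crossCount (S (J q.2.2.1)) q.2.2.1 (q.2.2.2 - q.1)) = a₃ ∧
      Nat.log 2 (crossCount (S (J q.2.2.2)) q.2.2.2 (q.2.2.2 - q.1)) = a₄) :
    ∑ q ∈ B, quadProd f q ≤ rectConst C * ((lam j₁ * lam j₃ * decay j₁ j₃) *
      (lam j₂ * lam j₄ * decay j₂ j₄) * (decay a₂ a₁ * decay a₃ a₁ * decay a₄ a₁)) := by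
  classical
  have l1 := hlam _ h1
  have l2 := hlam _ h2
  have l3 := hlam _ h3
  have l4 := hlam _ h4
  rcases B.eq_empty_or_nonempty with rfl | ⟨q₀, hq₀⟩
  · rw [Finset.sum_empty]
    have := decay_nonneg
    have e1 := mul_nonneg (mul_nonneg l1 l3) (this j₁ j₃)
    have e2 := mul_nonneg (mul_nonneg l2 l4) (this j₂ j₄)
    have e3 := mul_nonneg (mul_nonneg (this a₂ a₁) (this a₃ a₁)) (this a₄ a₁)
    have := mul_nonneg (mul_nonneg e1 e2) e3
    positivity
  set w := lam j₁ * lam j₂ * lam j₃ * lam j₄ * ((2 : ℝ) ^ (-(j₁ : ℝ) / 2) *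
    (2 : ℝ) ^ (-(j₂ : ℝ) / 2) * (2 : ℝ) ^ (-(j₃ : ℝ) / 2) * (2 : ℝ) ^ (-(j₄ : ℝ) / 2)) with hw
  have hw0 : 0 ≤ w := by rw [hw]; positivity
  have hval : ∀ q ∈ B, quadProd f q = w := by
    intro q hq
    obtain ⟨hl, ⟨rfl, rfl, rfl, rfl⟩, -⟩ := hB q hq
    simp only [lightRects, Finset.mem_filter, Finset.mem_product] at hl
    rw [quadProd, hf _ hl.1.1, hf _ hl.1.2.1, hf _ hl.1.2.2.1, hf _ hl.1.2.2.2, hw]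
    ring
  have hcard : (B.card : ℝ) ≤ rectConst C *
      (2 : ℝ) ^ (((j₁ : ℝ) + j₂ + j₃ + j₄) / 2 - (|(j₁ : ℝ) - j₃| + |(j₂ : ℝ) - j₄| +
      (|(a₂ : ℝ) - a₁| + |(a₃ : ℝ) - a₁| + |(a₄ : ℝ) - a₁|)) / 32) := by
    have hsub : B ⊆ rects (S j₁) (S j₂) (S j₃) (S j₄) a₁ a₂ a₃ a₄ := by
      rintro ⟨p₁, p₂, p₃, p₄⟩ hq
      obtain ⟨hl, ⟨rfl, rfl, rfl, rfl⟩, g⟩ := hB _ hq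
      simp only [lightRects, Finset.mem_filter, Finset.mem_product] at hl
      obtain ⟨hP, hpr, -⟩ := hl
      have hc (T : Finset Pt) (ξ : Pt) : crossCount T ξ (p₄ - p₁) = crossCount T ξ (p₂ - p₁) :=
        crossCount_of_perpendicular T ξ (sub_ne_zero.2 hpr.2.2.2) (sub_ne_zero.2 hpr.2.2.1)
          (by rw [dotProd_comm]; exact hpr.2.1)
      simp only [hc] at g
      rw [mem_rects]
      exact ⟨⟨hJ _ hP.1, hJ _ hP.2.1, hJ _ hP.2.2.1, hJ _ hP.2.2.2⟩, hpr, g⟩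
    refine (Nat.cast_le.2 (Finset.card_le_card hsub)).trans ?_
    obtain ⟨hl, ⟨rfl, rfl, rfl, rfl⟩, rfl, rfl, rfl, rfl⟩ := hB _ hq₀
    simp only [lightRects, Finset.mem_filter, Finset.mem_product] at hl
    obtain ⟨hP, hpr, ⟨t1, t2⟩, k1, k4⟩ := hl
    have k2 := k1
    rw [t1] at k2
    have k3 := k4
    rw [t2] at k3
    obtain ⟨c1, i1⟩ := two_le_sideType k1
    obtain ⟨c2, i2⟩ := two_le_sideType k2
    obtain ⟨c3, i3⟩ := two_le_sideType k3
    obtain ⟨c4, i4⟩ := two_le_sideType k4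
    refine card_rects_le (hS _ h1) (hS _ h2) (hS _ h3) (hS _ h4)
      (log_crossCount_le (hJ _ hP.1) c1) (log_crossCount_le (hJ _ hP.2.1) c2)
      (log_crossCount_le (hJ _ hP.2.2.1) c3) (log_crossCount_le (hJ _ hP.2.2.2) c4) ?_ ?_
    · rw [i1, i2, t1]
    · rw [i3, i4, t2]
  rw [Finset.sum_congr rfl hval, Finset.sum_const, nsmul_eq_mul]
  refine (mul_le_mul_of_nonneg_right hcard hw0).trans (le_of_eq ?_)
  have := rpow_sum_eq_decay j₁ j₂ j₃ j₄ a₁ a₂ a₃ a₄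
  rw [hw]
  linear_combination (rectConst C * (lam j₁ * lam j₂ * lam j₃ * lam j₄)) * this

theorem sum_lightRects_le (hlam : ∀ j ≤ m, 0 ≤ lam j) (hS : ∀ j ≤ m, (S j).card ≤ 2 ^ j)
    (hJm : ∀ p ∈ P, J p ≤ m) (hJ : ∀ p ∈ P, p ∈ S (J p))
    (hf : ∀ p ∈ P, f p = lam (J p) * (2 : ℝ) ^ (-(J p : ℝ) / 2)) :
    ∑ q ∈ lightRects P (sideType S J C), quadProd f q ≤
      rectConst C * (decaySum ^ 5 * (m + C + 1 : ℕ) *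
        (∑ j ∈ Finset.range (m + 1), lam j ^ 2) ^ 2) := by
  classical
  let φ : Pt × Pt × Pt × Pt → ((ℕ × ℕ) × (ℕ × ℕ)) × (ℕ × ℕ × ℕ × ℕ) := fun q =>
    (((J q.1, J q.2.2.1), (J q.2.1, J q.2.2.2)),
      (Nat.log 2 (crossCount (S (J q.1)) q.1 (q.2.2.2 - q.1)),
       Nat.log 2 (crossCount (S (J q.2.1)) q.2.1 (q.2.2.2 - q.1)),
       Nat.log 2 (crossCount (S (J q.2.2.1)) q.2.2.1 (q.2.2.2 - q.1)),
       Nat.log 2 (crossCount (S (J q.2.2.2)) q.2.2.2 (q.2.2.2 - q.1))))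
  set s := Finset.range (m + 1) with hs
  set t := Finset.range (m + C + 1) with ht
  have hmaps : ∀ q ∈ lightRects P (sideType S J C),
      φ q ∈ ((s ×ˢ s) ×ˢ (s ×ˢ s)) ×ˢ (t ×ˢ t ×ˢ t ×ˢ t) := by
    intro q hq
    simp only [lightRects, Finset.mem_filter, Finset.mem_product] at hq
    obtain ⟨⟨p1, p2, p3, p4⟩, hpr, ⟨t1, t2⟩, k1, k4⟩ := hq
    have k2 := k1
    rw [t1] at k2
    have k3 := k4
    rw [t2] at k3
    have b1 := log_crossCount_le (hJ _ p1) (two_le_sideType k1).1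
    have b2 := log_crossCount_le (hJ _ p2) (two_le_sideType k2).1
    have b3 := log_crossCount_le (hJ _ p3) (two_le_sideType k3).1
    have b4 := log_crossCount_le (hJ _ p4) (two_le_sideType k4).1
    have m1 := hJm _ p1
    have m2 := hJm _ p2
    have m3 := hJm _ p3
    have m4 := hJm _ p4
    simp only [φ, hs, ht, Finset.mem_product, Finset.mem_range]
    omega
  rw [← Finset.sum_fiberwise_of_maps_to hmaps, ← Finset.card_range (m + C + 1), ← ht]
  refine le_trans ?_ (mul_le_mul_of_nonneg_left (sum_decay_classes_le s t (l := lam) ?_)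
    (Nat.cast_nonneg _))
  · rw [Finset.mul_sum]
    refine Finset.sum_le_sum fun i hi => ?_
    simp only [hs, Finset.mem_product, Finset.mem_range, Nat.lt_succ_iff] at hi
    refine sum_lightRects_class_le hlam hS hJ hf hi.1.1.1 hi.1.2.1 hi.1.1.2 hi.1.2.2 ?_
    intro q hq
    rw [Finset.mem_filter] at hq
    obtain ⟨hq, rfl⟩ := hq
    exact ⟨hq, ⟨rfl, rfl, rfl, rfl⟩, rfl, rfl, rfl, rfl⟩
  · intro j hj
    exact hlam j (Nat.lt_succ_iff.1 (Finset.mem_range.1 hj))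

end

/-- The real line through `p` with direction `d`. -/
def realLine (p d : Pt) : Set (ℝ × ℝ) := {x | ∃ t : ℝ, x = emb p + t • emb d}

lemma emb_injective : Function.Injective emb := by
  intro p q h
  simp only [emb, Prod.mk.injEq, Int.cast_inj] at h
  exact Prod.ext h.1 h.2

lemma isLine_realLine (p : Pt) {d : Pt} (hd : d ≠ 0) : IsLine (realLine p d) := by
  refine ⟨emb p, emb d, fun h => hd (emb_injective ?_), rfl⟩
  rw [h]
  simp [emb, Prod.ext_iff]

lemma emb_mem_realLine_self (p d : Pt) : emb p ∈ realLine p d := ⟨0, by simp⟩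

lemma emb_mem_realLine {p q d : Pt} (hd : d ≠ 0) (h : crossProd d (q - p) = 0) :
    emb q ∈ realLine p d := by
  have h' : (d.1 : ℝ) * (q.2 - p.2) - d.2 * (q.1 - p.1) = 0 := by
    simp only [crossProd, Prod.fst_sub, Prod.snd_sub] at h
    exact_mod_cast h
  by_cases h1 : d.1 = 0
  · have h2 : (d.2 : ℝ) ≠ 0 := by
      intro h2
      exact hd (Prod.ext h1 (by exact_mod_cast h2))
    refine ⟨(q.2 - p.2) / d.2, Prod.ext ?_ ?_⟩ <;>
    simp only [emb, Prod.fst_add, Prod.snd_add, Prod.smul_fst, Prod.smul_snd, smul_eq_mul] <;>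
    field_simp <;> linarith
  · have h2 : (d.1 : ℝ) ≠ 0 := by exact_mod_cast h1
    refine ⟨(q.1 - p.1) / d.1, Prod.ext ?_ ?_⟩ <;>
    simp only [emb, Prod.fst_add, Prod.snd_add, Prod.smul_fst, Prod.smul_snd, smul_eq_mul] <;>
    field_simp <;> linarith

lemma crossProd_eq_zero_of_realLine_eq {p d e : Pt} (h : realLine p d = realLine p e) :
    crossProd d e = 0 := by
  have he : emb p + (1 : ℝ) • emb e ∈ realLine p d := h ▸ ⟨1, rfl⟩
  obtain ⟨t, ht⟩ := he
  rw [one_smul] at ht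
  have ht' := add_left_cancel ht
  simp only [emb, Prod.smul_mk, smul_eq_mul, Prod.mk.injEq] at ht'
  have : (d.1 : ℝ) * e.2 - d.2 * e.1 = 0 := by
    rw [ht'.1, ht'.2]; ring
  exact_mod_cast this

lemma card_ptsOn_le_lineCount (T : Finset Pt) (p : Pt) {d : Pt} (hd : d ≠ 0) :
    (ptsOn T p d).card ≤ lineCount (realLine p d) T := by
  have h : emb '' (ptsOn T p d : Set Pt) ⊆ realLine p d ∩ emb '' (T : Set Pt) := by
    rintro _ ⟨q, hq, rfl⟩
    rw [Finset.mem_coe, mem_ptsOn] at hq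
    exact ⟨emb_mem_realLine hd hq.2, q, hq.1, rfl⟩
  calc (ptsOn T p d).card = (emb '' (ptsOn T p d : Set Pt)).ncard := by
        rw [Set.ncard_image_of_injective _ emb_injective, Set.ncard_coe_finset]
    _ ≤ _ := Set.ncard_le_ncard h (Set.Finite.inter_of_right (T.finite_toSet.image _) _)

lemma rpow_le_of_pow_le_sq {j C N : ℕ} (h : 2 ^ (j + 2 * C) ≤ N ^ 2) :
    (2 : ℝ) ^ ((j : ℝ) / 2 + (C : ℝ)) ≤ N := by
  refine le_of_sq_le_sq ?_ (Nat.cast_nonneg N)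
  have h1 : ((2 : ℝ) ^ ((j : ℝ) / 2 + (C : ℝ))) ^ 2 = 2 ^ (j + 2 * C) := by
    rw [← Real.rpow_natCast, ← Real.rpow_mul (by norm_num), ← Real.rpow_natCast]
    congr 1
    push_cast
    ring
  rw [h1]
  exact_mod_cast h

lemma crossProd_eq_zero_of_sideType {S : ℕ → Finset Pt} {J : Pt → ℕ} {C : ℕ} {p d e : Pt}
    (hp : ∀ ℓ₁ ℓ₂ : Set (ℝ × ℝ), IsLine ℓ₁ → IsLine ℓ₂ → emb p ∈ ℓ₁ → emb p ∈ ℓ₂ →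
      (2 : ℝ) ^ ((J p : ℝ) / 2 + (C : ℝ)) ≤ (lineCount ℓ₁ (S (J p)) : ℝ) →
      (2 : ℝ) ^ ((J p : ℝ) / 2 + (C : ℝ)) ≤ (lineCount ℓ₂ (S (J p)) : ℝ) → ℓ₁ = ℓ₂)
    (hd : d ≠ 0) (he : e ≠ 0) (h : sideType S J C p d = sideType S J C p e)
    (h2 : sideType S J C p d < 2) : crossProd d e = 0 := by
  have key {d e : Pt} (hd : d ≠ 0) (he : e ≠ 0)
      (h1 : 2 ^ (J p + 2 * C) ≤ (ptsOn (S (J p)) p d).card ^ 2)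
      (h2 : 2 ^ (J p + 2 * C) ≤ (ptsOn (S (J p)) p e).card ^ 2) : crossProd d e = 0 :=
    crossProd_eq_zero_of_realLine_eq (hp _ _ (isLine_realLine p hd) (isLine_realLine p he)
      (emb_mem_realLine_self p d) (emb_mem_realLine_self p e)
      ((rpow_le_of_pow_le_sq h1).trans (Nat.cast_le.2 (card_ptsOn_le_lineCount _ p hd)))
      ((rpow_le_of_pow_le_sq h2).trans (Nat.cast_le.2 (card_ptsOn_le_lineCount _ p he))))
  unfold sideType at h h2
  split_ifs at h h2 with c1 c2 c3 c4 c5 c6 <;> first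
    | exact key hd he ‹_› ‹_›
    | exact (crossProd_perp_perp d e).symm.trans
        (key (perp_ne_zero hd) (perp_ne_zero he) ‹_› ‹_›)
    | exact absurd h (by decide)
    | exact absurd h2 (by decide)

lemma tsum_rect_eq_sum {f : Pt → ℝ} {P : Finset Pt} (hf : ∀ p ∉ P, f p = 0) :
    ∑' Q : Quad, Set.indicator {Q : Quad | IsRect Q} (fQ f) Q =
      ∑ q ∈ allRects P, quadProd f q := by
  classical
  let ψ : Pt × Pt × Pt × Pt → Quad := fun q => ![q.1, q.2.1, q.2.2.1, q.2.2.2]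
  have hψ : Function.Injective ψ := by
    intro q r h
    have h0 := congrFun h 0
    have h1 := congrFun h 1
    have h2 := congrFun h 2
    have h3 := congrFun h 3
    exact Prod.ext h0 (Prod.ext h1 (Prod.ext h2 h3))
  have hrect (q : Pt × Pt × Pt × Pt) : IsRect (ψ q) ↔
      q.1 + q.2.2.1 = q.2.1 + q.2.2.2 ∧ dotProd (q.2.1 - q.1) (q.2.2.2 - q.1) = 0 := by
    have : dotQ (ψ q) = dotProd (q.2.1 - q.1) (q.2.2.2 - q.1) := by
      simp only [dotQ, dotProd, ψ, Prod.fst_sub, Prod.snd_sub, Matrix.cons_val]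
      ring
    rw [IsRect, this]
    rfl
  have hprod (q : Pt × Pt × Pt × Pt) : fQ f (ψ q) = quadProd f q := by
    rw [fQ, Fin.prod_univ_four]
    rfl
  rw [tsum_eq_sum (s := (allRects P).image ψ), Finset.sum_image fun _ _ _ _ h => hψ h]
  · refine Finset.sum_congr rfl fun q hq => ?_
    rw [allRects, Finset.mem_filter] at hq
    rw [Set.indicator_of_mem (by exact (hrect q).2 hq.2), hprod]
  · intro Q hQ
    refine Set.indicator_apply_eq_zero.2 fun hR => ?_
    by_contra hne
    refine hQ (Finset.mem_image.2 ⟨(Q 0, Q 1, Q 2, Q 3), ?_, ?_⟩)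
    · have hm (k : Fin 4) : Q k ∈ P := by
        by_contra hk
        exact hne (Finset.prod_eq_zero (Finset.mem_univ k) (hf _ hk))
      have hQ' : ψ (Q 0, Q 1, Q 2, Q 3) = Q := by
        ext k : 1
        fin_cases k <;> rfl
      have hR' : IsRect (ψ (Q 0, Q 1, Q 2, Q 3)) := hQ'.symm ▸ hR
      rw [allRects, Finset.mem_filter]
      simp only [Finset.mem_product]
      exact ⟨⟨hm 0, hm 1, hm 2, hm 3⟩, (hrect _).1 hR'⟩
    · ext k : 1
      fin_cases k <;> rfl

lemma sum_sq_le_of_card_le {S : ℕ → Finset Pt} {J : Pt → ℕ} {lam : ℕ → ℝ} {f : Pt → ℝ} {m : ℕ}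
    {P : Finset Pt} (hS : ∀ j ≤ m, (S j).card ≤ 2 ^ j) (hJm : ∀ p ∈ P, J p ≤ m)
    (hJ : ∀ p ∈ P, p ∈ S (J p))
    (hf : ∀ p ∈ P, f p = lam (J p) * (2 : ℝ) ^ (-(J p : ℝ) / 2)) :
    ∑ p ∈ P, f p ^ 2 ≤ ∑ j ∈ Finset.range (m + 1), lam j ^ 2 := by
  rw [← Finset.sum_fiberwise_of_maps_to (t := Finset.range (m + 1)) (g := J)
    fun p hp => Finset.mem_range.2 (Nat.lt_succ_of_le (hJm p hp))]
  refine Finset.sum_le_sum fun j hj => ?_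
  have hj' : j ≤ m := Nat.lt_succ_iff.1 (Finset.mem_range.1 hj)
  have hval : ∀ p ∈ P.filter (fun p => J p = j), f p ^ 2 = lam j ^ 2 * ((2 : ℝ) ^ j)⁻¹ := by
    intro p hp
    obtain ⟨hpP, rfl⟩ := Finset.mem_filter.1 hp
    rw [hf p hpP, mul_pow, ← Real.rpow_natCast ((2 : ℝ) ^ (-(J p : ℝ) / 2)),
      ← Real.rpow_mul (by norm_num), ← Real.rpow_natCast 2 (J p), ← Real.rpow_neg (by norm_num)]
    congr 2
    push_cast
    ring
  rw [Finset.sum_congr rfl hval, Finset.sum_const, nsmul_eq_mul]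
  have hsub : P.filter (fun p => J p = j) ⊆ S j := by
    intro p hp
    obtain ⟨hpP, rfl⟩ := Finset.mem_filter.1 hp
    exact hJ p hpP
  have hcard : ((P.filter fun p => J p = j).card : ℝ) ≤ 2 ^ j := by
    exact_mod_cast (Finset.card_le_card hsub).trans (hS j hj')
  calc _ ≤ (2 : ℝ) ^ j * (lam j ^ 2 * ((2 : ℝ) ^ j)⁻¹) := by gcongr
    _ = lam j ^ 2 := by field_simp

/-- **Estimate (3.1) of Proposition 3.1.** `Σ_{Q ∈ 𝒬⁰} f(Q) ≲ m ‖λ‖_{ℓ²}⁴`. -/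
theorem sum_rectangles_bound (C : ℕ) :
    ∃ c : ℝ, 0 < c ∧
      ∀ (m : ℕ) (S : ℕ → Finset Pt) (lam : ℕ → ℝ),
        1 ≤ m →
        (∀ i ≤ m, ∀ j ≤ m, i ≠ j → Disjoint (S i) (S j)) →
        (∀ j ≤ m, (S j).card ≤ 2 ^ j) →
        (∀ j ≤ m, 0 ≤ lam j) →
        (∀ j ≤ m, ∀ ξ ∈ S j, ∀ ℓ₁ ℓ₂ : Set (ℝ × ℝ), IsLine ℓ₁ → IsLine ℓ₂ →
          emb ξ ∈ ℓ₁ → emb ξ ∈ ℓ₂ →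
          (2 : ℝ) ^ ((j : ℝ) / 2 + (C : ℝ)) ≤ (lineCount ℓ₁ (S j) : ℝ) →
          (2 : ℝ) ^ ((j : ℝ) / 2 + (C : ℝ)) ≤ (lineCount ℓ₂ (S j) : ℝ) → ℓ₁ = ℓ₂) →
        ∑' Q : Quad, Set.indicator {Q : Quad | IsRect Q} (fQ (fWt S lam m)) Q ≤
          c * m * (∑ j ∈ Finset.range (m + 1), lam j ^ 2) ^ 2 := by
  classical
  have hG := decaySum_pos
  refine ⟨16 * (6 + rectConst C * decaySum ^ 5 * (C + 2)), by positivity, ?_⟩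
  intro m S lam hm hdisj hS hlam hline
  set P := (Finset.range (m + 1)).biUnion S with hP
  have hmem (p : Pt) : p ∈ P ↔ ∃ j, j ≤ m ∧ p ∈ S j := by
    simp [hP]
  have hex (p : Pt) : ∃ j, p ∈ P → j ≤ m ∧ p ∈ S j := by
    by_cases hp : p ∈ P
    · obtain ⟨j, hj⟩ := (hmem p).1 hp
      exact ⟨j, fun _ => hj⟩
    · exact ⟨0, fun h => absurd h hp⟩
  choose J hJ' using hex
  have hJm : ∀ p ∈ P, J p ≤ m := fun p hp => (hJ' p hp).1
  have hJ : ∀ p ∈ P, p ∈ S (J p) := fun p hp => (hJ' p hp).2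
  have hf0 : ∀ p ∉ P, fWt S lam m p = 0 := by
    intro p hp
    refine Finset.sum_eq_zero fun j hj => if_neg fun h => hp ?_
    exact (hmem p).2 ⟨j, Nat.lt_succ_iff.1 (Finset.mem_range.1 hj), h⟩
  have hf : ∀ p ∈ P, fWt S lam m p = lam (J p) * (2 : ℝ) ^ (-(J p : ℝ) / 2) := by
    intro p hp
    rw [fWt, Finset.sum_eq_single (J p), if_pos (hJ p hp)]
    · intro j hj hne
      refine if_neg fun h => ?_
      exact Finset.disjoint_left.1
        (hdisj j (Nat.lt_succ_iff.1 (Finset.mem_range.1 hj)) _ (hJm p hp) hne) h (hJ p hp)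
    · exact fun h => absurd (Finset.mem_range.2 (Nat.lt_succ_of_le (hJm p hp))) h
  have hfnonneg : ∀ p, 0 ≤ fWt S lam m p := by
    intro p
    refine Finset.sum_nonneg fun j hj => ?_
    split_ifs
    · exact mul_nonneg (hlam j (Nat.lt_succ_iff.1 (Finset.mem_range.1 hj))) (by positivity)
    · exact le_rfl
  rw [tsum_rect_eq_sum hf0]
  have h1 := sum_allRects_le hfnonneg (P := P) (vt := sideType S J C)
    fun p hp d e hd he h h2 =>
      crossProd_eq_zero_of_sideType (hline _ (hJm p hp) p (hJ p hp)) hd he h h2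
  have h2 := sum_lightRects_le (C := C) hlam hS hJm hJ hf
  have h3 := sum_sq_le_of_card_le hS hJm hJ hf
  have h4 : (∑ p ∈ P, fWt S lam m p ^ 2) ^ 2 ≤ (∑ j ∈ Finset.range (m + 1), lam j ^ 2) ^ 2 :=
    pow_le_pow_left₀ (Finset.sum_nonneg fun _ _ => sq_nonneg _) h3 2
  have hm' : (1 : ℝ) ≤ m := by exact_mod_cast hm
  set Λ := (∑ j ∈ Finset.range (m + 1), lam j ^ 2) ^ 2 with hΛ
  have hΛ0 : 0 ≤ Λ := sq_nonneg _
  have h5 : (rectConst C : ℝ) * (decaySum ^ 5 * (m + C + 1 : ℕ) * Λ) ≤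
      rectConst C * (decaySum ^ 5 * ((C + 2) * m) * Λ) := by
    have : ((m + C + 1 : ℕ) : ℝ) ≤ (C + 2) * m := by
      push_cast
      nlinarith [mul_nonneg (Nat.cast_nonneg (α := ℝ) C) (sub_nonneg.2 hm')]
    gcongr
  have h6 : Λ ≤ m * Λ := le_mul_of_one_le_left hΛ0 hm'
  linarith
end
end
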